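/- arXiv:1703.01215 — 4 statements merged into one kernel-verified Lean document; each statement's English description precedes it below -/
import Mathlib

section
/- Let p be an odd prime and α ∈ ℤ_p with ⟨−α⟩_p even. Then for every z ∈ ℤ_p, ∑_{k=0}^{p−1} (α)_k(1−α)_k/(k!)² · z^k ≡ ∑_{k=0}^{p−1} (α/2)_k((1−α)/2)_k/(k!)² · (4z(1−z))^k (mod p²). (This is the p-adic analogue of the quadratic transformation ₂F₁[α,1−α;1|z] = ₂F₁[α/2,(1−α)/2;1|4z(1−z)] for the truncated series.) -/
open scoped BigOperators

/-- The Pochhammer symbol `(x)_k = x(x+1)⋯(x+k-1)` in `ℚ_[p]`. -/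
noncomputable def poch (p : ℕ) [Fact p.Prime] (x : ℚ_[p]) (k : ℕ) : ℚ_[p] :=
  (ascPochhammer ℚ_[p] k).eval x

/-- The least non-negative residue `⟨α⟩_p ∈ {0,…,p-1}` of `α ∈ ℤ_[p]` modulo `p`. -/
noncomputable def res (p : ℕ) [Fact p.Prime] (α : ℤ_[p]) : ℕ :=
  (PadicInt.toZMod α).val

open Polynomial in
/-- The hypergeometric differential operator `e X(1-X) ∂² + (e - fX) ∂ - s`. -/
noncomputable def hypOp {R : Type*} [CommRing R] (e f s : R) (F : R[X]) : R[X] :=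
  C e * X * (1 - X) * derivative (derivative F) + (C e - C f * X) * derivative F - C s * F

open Polynomial in
lemma coeff_hypOp {R : Type*} [CommRing R] (e f s : R) (F : R[X]) (k : ℕ) :
    (hypOp e f s F).coeff k =
      e * (k + 1) ^ 2 * F.coeff (k + 1) - (e * k * (k - 1) + f * k + s) * F.coeff k := by
  have h : hypOp e f s F = C e * (X * derivative (derivative F))
      - C e * (X * (X * derivative (derivative F))) + C e * derivative F
      - C f * (X * derivative F) - C s * F := by
    unfold hypOp; ring
  rw [h]
  rcases k with _ | _ | k <;>
    simp [coeff_X_mul, coeff_derivative, mul_coeff_zero] <;> ring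

open Polynomial in
/-- Quadratic change of variable in the hypergeometric operator. -/
lemma hypOp_comp {R : Type*} [CommRing R] (s : R) (F : R[X]) :
    hypOp 1 2 s (F.comp (4 * X * (1 - X))) = (hypOp 4 6 s F).comp (4 * X * (1 - X)) := by
  have h1 : derivative (4 * X * (1 - X) : R[X]) = 4 * (1 - 2 * X) := by
    simp [derivative_mul]; ring
  have h2 : derivative (4 * (1 - 2 * X) : R[X]) = -8 := by
    simp [derivative_mul]; ring
  have e4 : (C 4 : R[X]) = 4 := map_ofNat C 4
  have e6 : (C 6 : R[X]) = 6 := map_ofNat C 6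
  have e2 : (C 2 : R[X]) = 2 := map_ofNat C 2
  have o4 : ((4 : R[X]).comp (4 * X * (1 - X))) = 4 := by simp
  have o6 : ((6 : R[X]).comp (4 * X * (1 - X))) = 6 := by simp
  simp only [hypOp, derivative_comp, derivative_mul, h1, h2, add_comp, sub_comp, mul_comp, X_comp,
    C_comp, one_comp, e4, e6, e2, o4, o6, C_1]
  ring

open Polynomial in
lemma eq_of_hypOp_eq_zero {R : Type*} [CommRing R] {n : ℕ} {s : R} {F G : R[X]}
    (hu : ∀ k : ℕ, k + 1 < n → IsUnit ((k : R) + 1))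
    (hFd : ∀ k, n ≤ k → F.coeff k = 0) (hGd : ∀ k, n ≤ k → G.coeff k = 0)
    (h0 : F.coeff 0 = G.coeff 0)
    (hF : hypOp 1 2 s F = 0) (hG : hypOp 1 2 s G = 0) : F = G := by
  ext k
  induction k with
  | zero => exact h0
  | succ k ih =>
    rcases lt_or_ge (k + 1) n with hk | hk
    · have h1 := coeff_hypOp 1 2 s F k
      have h2 := coeff_hypOp 1 2 s G k
      rw [hF, coeff_zero] at h1
      rw [hG, coeff_zero] at h2
      apply ((hu k hk).pow 2).mul_left_cancel
      rw [ih] at h1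
      linear_combination h2 - h1
    · rw [hFd _ hk, hGd _ hk]

open Polynomial in
lemma coeff_truncated {R : Type*} [CommRing R] (c : ℕ → R) (n k : ℕ) :
    (∑ i ∈ Finset.range n, C (c i) * X ^ i).coeff k = if k < n then c k else 0 := by
  simp [finsetSum_coeff]

open Polynomial in
lemma hypOp_truncated_eq_zero {R : Type*} [CommRing R] {e f s : R} {c : ℕ → R} {n : ℕ}
    (hrec : ∀ k, k < n →
      e * (k + 1) ^ 2 * c (k + 1) = (e * k * (k - 1) + f * k + s) * c k)
    (hlast : (e * n * (n - 1) + f * n + s) * c n = 0) :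
    hypOp e f s (∑ i ∈ Finset.range (n + 1), C (c i) * X ^ i) = 0 := by
  ext k
  rw [coeff_hypOp, coeff_truncated, coeff_truncated, coeff_zero]
  rcases lt_trichotomy k n with hk | rfl | hk
  · rw [if_pos (by omega), if_pos (by omega), hrec k hk, sub_self]
  · simp [hlast]
  · rw [if_neg (by omega), if_neg (by omega)]; simp

open Polynomial in
/-- Quadratic transformation for truncated series over a ring in which the recurrences terminate. -/
lemma truncated_quadratic_transformation {R : Type*} [CommRing R] {s : R} {c d : ℕ → R} {N : ℕ}
    (hu : ∀ k : ℕ, k < 2 * N → IsUnit ((k : R) + 1)) (h0 : c 0 = d 0)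
    (hc : ∀ k, k < 2 * N → ((k : R) + 1) ^ 2 * c (k + 1) = (k * (k + 1) + s) * c k)
    (hc' : ((2 * N : R) * (2 * N + 1) + s) * c (2 * N) = 0)
    (hd : ∀ k, k < N → 4 * ((k : R) + 1) ^ 2 * d (k + 1) = (2 * k * (2 * k + 1) + s) * d k)
    (hd' : ((2 * N : R) * (2 * N + 1) + s) * d N = 0) (z : R) :
    ∑ k ∈ Finset.range (2 * N + 1), c k * z ^ k =
      ∑ k ∈ Finset.range (N + 1), d k * (4 * z * (1 - z)) ^ k := by
  set F : R[X] := ∑ i ∈ Finset.range (2 * N + 1), C (c i) * X ^ i with hF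
  set G : R[X] := ∑ i ∈ Finset.range (N + 1), C (d i) * X ^ i with hG
  have key : F = G.comp (4 * X * (1 - X)) := by
    refine eq_of_hypOp_eq_zero (n := 2 * N + 1) (s := s) (fun k hk => hu k (by omega)) ?_ ?_ ?_ ?_ ?_
    · intro k hk
      rw [hF, coeff_truncated, if_neg (by omega)]
    · intro k hk
      apply coeff_eq_zero_of_natDegree_lt
      have h1 : G.natDegree ≤ N := by
        rw [natDegree_le_iff_coeff_eq_zero]
        intro k hk
        rw [hG, coeff_truncated, if_neg (by omega)]
      have h2 : (4 * X * (1 - X) : R[X]).natDegree ≤ 2 := by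
        have : (4 * X * (1 - X) : R[X]) = C 4 * (X * (1 - X)) := by
          rw [show (C 4 : R[X]) = 4 from map_ofNat C 4, mul_assoc]
        rw [this]
        compute_degree
      calc _ ≤ G.natDegree * (4 * X * (1 - X) : R[X]).natDegree := natDegree_comp_le
        _ ≤ N * 2 := Nat.mul_le_mul h1 h2
        _ < k := by omega
    · rw [coeff_zero_eq_eval_zero (G.comp _), eval_comp]
      simp only [eval_mul, eval_X, mul_zero, zero_mul, ← coeff_zero_eq_eval_zero]
      rw [hF, hG, coeff_truncated, coeff_truncated]
      simp [h0]
    · apply hypOp_truncated_eq_zero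
      · intro k hk
        linear_combination hc k hk
      · push_cast
        linear_combination hc'
    · rw [hypOp_comp, hypOp_truncated_eq_zero, zero_comp]
      · intro k hk
        linear_combination hd k hk
      · linear_combination hd'
  have := congrArg (eval z) key
  simpa [hF, hG, eval_finsetSum, eval_comp] using this

lemma dvd_ascPochhammer_eval {R : Type*} [CommRing R] {q x : R} {m k : ℕ} (h : q ∣ x + m)
    (hk : m < k) : q ∣ (ascPochhammer R k).eval x := by
  induction k with
  | zero => omega
  | succ k ih =>
    rw [ascPochhammer_succ_eval]
    rcases Nat.lt_succ_iff_lt_or_eq.mp hk with h' | rfl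
    · exact (ih h').mul_right _
    · exact h.mul_left _

lemma isUnit_padicInt_natCast {p : ℕ} [Fact p.Prime] {k : ℕ} (h0 : 0 < k) (hk : k < p) :
    IsUnit (k : ℤ_[p]) := by
  rw [PadicInt.isUnit_iff]
  by_contra h
  have h1 := lt_of_le_of_ne (PadicInt.norm_le_one (k : ℤ_[p])) h
  have h2 := (PadicInt.norm_int_lt_one_iff_dvd (p := p) (k : ℤ)).mp (by simpa using h1)
  exact absurd (Nat.le_of_dvd h0 (by exact_mod_cast h2)) (by omega)

lemma isUnit_padicInt_factorial {p : ℕ} [Fact p.Prime] {k : ℕ} (hk : k < p) :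
    IsUnit (k.factorial : ℤ_[p]) := by
  induction k with
  | zero => simp
  | succ k ih =>
    rw [Nat.factorial_succ, Nat.cast_mul]
    exact (isUnit_padicInt_natCast (by omega) hk).mul (ih (by omega))

/-- The coefficient `(x)_k (y)_k / (k!)²` as a `p`-adic integer (meaningful for `k < p`). -/
noncomputable def hypCoeff {p : ℕ} [Fact p.Prime] (x y : ℤ_[p]) (k : ℕ) : ℤ_[p] :=
  (ascPochhammer ℤ_[p] k).eval x * (ascPochhammer ℤ_[p] k).eval y *
    Ring.inverse (k.factorial : ℤ_[p]) ^ 2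

lemma hypCoeff_mul {p : ℕ} [Fact p.Prime] (x y : ℤ_[p]) {k : ℕ} (hk : k < p) :
    (k.factorial : ℤ_[p]) ^ 2 * hypCoeff x y k =
      (ascPochhammer ℤ_[p] k).eval x * (ascPochhammer ℤ_[p] k).eval y := by
  have h := Ring.mul_inverse_cancel _ (isUnit_padicInt_factorial (p := p) hk)
  unfold hypCoeff
  linear_combination ((ascPochhammer ℤ_[p] k).eval x * (ascPochhammer ℤ_[p] k).eval y) *
    ((k.factorial : ℤ_[p]) * Ring.inverse (k.factorial : ℤ_[p]) + 1) * h

lemma coe_ascPochhammer_eval {p : ℕ} [Fact p.Prime] (x : ℤ_[p]) (k : ℕ) :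
    (((ascPochhammer ℤ_[p] k).eval x : ℤ_[p]) : ℚ_[p]) = poch p x k := by
  unfold poch
  induction k with
  | zero => simp
  | succ k ih => simp [ascPochhammer_succ_eval, ih]

lemma coe_hypCoeff {p : ℕ} [Fact p.Prime] (x y : ℤ_[p]) {k : ℕ} (hk : k < p) :
    ((hypCoeff x y k : ℤ_[p]) : ℚ_[p]) =
      poch p x k * poch p y k / (k.factorial : ℚ_[p]) ^ 2 := by
  have h := congrArg (fun t : ℤ_[p] => (t : ℚ_[p])) (hypCoeff_mul x y hk)
  simp only [PadicInt.coe_mul, PadicInt.coe_pow, PadicInt.coe_natCast,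
    coe_ascPochhammer_eval] at h
  have h0 : (k.factorial : ℚ_[p]) ≠ 0 := by exact_mod_cast k.factorial_ne_zero
  rw [← h]
  field_simp

lemma hypCoeff_succ {p : ℕ} [Fact p.Prime] (x y : ℤ_[p]) {k : ℕ} (hk : k + 1 < p) :
    ((k : ℤ_[p]) + 1) ^ 2 * hypCoeff x y (k + 1) = (x + k) * (y + k) * hypCoeff x y k := by
  have h1 := hypCoeff_mul x y (show k < p by omega)
  have h2 := hypCoeff_mul x y hk
  rw [Nat.factorial_succ, ascPochhammer_succ_eval, ascPochhammer_succ_eval] at h2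
  apply ((isUnit_padicInt_factorial (p := p) (show k < p by omega)).pow 2).mul_left_cancel
  push_cast at h2
  linear_combination h2 - (x + k) * (y + k) * h1

/-- If both Pochhammer symbols pick up a factor `p` by index `k`, then the next term of the
recurrence is divisible by `p²`. -/
lemma sq_dvd_mul_hypCoeff {p : ℕ} [Fact p.Prime] {x y : ℤ_[p]} {m n k : ℕ}
    (hx : (p : ℤ_[p]) ∣ x + m) (hy : (p : ℤ_[p]) ∣ y + n) (hm : m ≤ k) (hn : n ≤ k) (hk : k < p) :
    (p : ℤ_[p]) ^ 2 ∣ (x + k) * (y + k) * hypCoeff x y k := by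
  have h1 := hypCoeff_mul x y hk
  rw [← ((isUnit_padicInt_factorial (p := p) hk).pow 2).dvd_mul_left]
  have h2 := mul_dvd_mul (dvd_ascPochhammer_eval hx (Nat.lt_succ_of_le hm))
    (dvd_ascPochhammer_eval hy (Nat.lt_succ_of_le hn))
  rw [ascPochhammer_succ_eval, ascPochhammer_succ_eval] at h2
  convert h2 using 1
  · ring
  · linear_combination (x + k) * (y + k) * h1

lemma sq_dvd_hypCoeff {p : ℕ} [Fact p.Prime] {x y : ℤ_[p]} {m n k : ℕ}
    (hx : (p : ℤ_[p]) ∣ x + m) (hy : (p : ℤ_[p]) ∣ y + n) (hm : m < k) (hn : n < k) :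
    (p : ℤ_[p]) ^ 2 ∣ hypCoeff x y k := by
  unfold hypCoeff
  rw [sq]
  exact (mul_dvd_mul (dvd_ascPochhammer_eval hx hm) (dvd_ascPochhammer_eval hy hn)).mul_right _

lemma toZModPow_eq_zero_iff {p : ℕ} [Fact p.Prime] (n : ℕ) (x : ℤ_[p]) :
    PadicInt.toZModPow n x = 0 ↔ (p : ℤ_[p]) ^ n ∣ x := by
  rw [← RingHom.mem_ker, PadicInt.ker_toZModPow, Ideal.mem_span_singleton]

lemma dvd_add_res_neg {p : ℕ} [Fact p.Prime] (α : ℤ_[p]) :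
    (p : ℤ_[p]) ∣ α + (res p (-α) : ℕ) := by
  rw [← Ideal.mem_span_singleton, ← PadicInt.maximalIdeal_eq_span_p, ← PadicInt.ker_toZMod,
    RingHom.mem_ker, map_add, map_natCast, res, ZMod.natCast_zmod_val, map_neg, add_neg_cancel]

/-- p-adic analogue of the quadratic transformation
`₂F₁[α,1−α;1|z] = ₂F₁[α/2,(1−α)/2;1|4z(1−z)]` for truncated series mod `p²`. -/
theorem padic_quadratic_transformation_I
    (p : ℕ) [Fact p.Prime] (hp : Odd p) (α : ℤ_[p]) (hα : Even (res p (-α))) (z : ℤ_[p]) :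
    ‖(∑ k ∈ Finset.range p,
        poch p (α : ℚ_[p]) k * poch p (1 - (α : ℚ_[p])) k / (Nat.factorial k : ℚ_[p]) ^ 2
          * (z : ℚ_[p]) ^ k)
      - ∑ k ∈ Finset.range p,
          poch p ((α : ℚ_[p]) / 2) k * poch p ((1 - (α : ℚ_[p])) / 2) k
            / (Nat.factorial k : ℚ_[p]) ^ 2 * (4 * (z : ℚ_[p]) * (1 - (z : ℚ_[p]))) ^ k‖
      ≤ (p : ℝ) ^ (-2 : ℤ) := by
  have hap : res p (-α) < p := ZMod.val_lt _
  have hdvd := dvd_add_res_neg α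
  obtain ⟨a, ha⟩ := hα
  obtain ⟨N, hN⟩ := hp
  have hp2 : 2 < p := by have := (Fact.out : p.Prime).two_le; omega
  have hpc : (p : ℤ_[p]) = 2 * N + 1 := by exact_mod_cast congrArg (Nat.cast : ℕ → ℤ_[p]) hN
  have h2u : IsUnit (2 : ℤ_[p]) := by
    simpa using isUnit_padicInt_natCast (p := p) (k := 2) (by omega) hp2
  obtain ⟨h, hh⟩ := h2u.exists_right_inv
  obtain ⟨b, hb⟩ : ∃ b, a + b = N := ⟨N - a, by omega⟩
  rw [ha] at hdvd
  push_cast at hdvd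
  have hbN : (a : ℤ_[p]) + b = N := by exact_mod_cast hb
  set β := α * h with hβ
  set γ := (1 - α) * h with hγ
  have hβ2 : 2 * β = α := by linear_combination α * hh
  have hγ2 : 2 * γ = 1 - α := by linear_combination (1 - α) * hh
  have dα : (p : ℤ_[p]) ∣ α + (2 * a : ℕ) := by
    push_cast; rwa [two_mul]
  have dα' : (p : ℤ_[p]) ∣ (1 - α) + (2 * b : ℕ) := by
    have := (dvd_refl (p : ℤ_[p])).sub hdvd
    convert this using 1
    push_cast
    linear_combination 2 * hbN - hpc
  have dβ : (p : ℤ_[p]) ∣ β + a := by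
    rw [← h2u.dvd_mul_left]
    convert dα using 1
    push_cast
    linear_combination hβ2
  have dγ : (p : ℤ_[p]) ∣ γ + b := by
    rw [← h2u.dvd_mul_left]
    convert dα' using 1
    push_cast
    linear_combination hγ2
  set φ : ℤ_[p] →+* ZMod (p ^ 2) := PadicInt.toZModPow 2 with hφ
  have main : φ (∑ k ∈ Finset.range p, hypCoeff α (1 - α) k * z ^ k
      - ∑ k ∈ Finset.range p, hypCoeff β γ k * (4 * z * (1 - z)) ^ k) = 0 := by
    have hsub : ∑ k ∈ Finset.range p, φ (hypCoeff β γ k) * (4 * φ z * (1 - φ z)) ^ k =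
        ∑ k ∈ Finset.range (N + 1), φ (hypCoeff β γ k) * (4 * φ z * (1 - φ z)) ^ k := by
      symm
      apply Finset.sum_subset
      · intro k hk
        simp only [Finset.mem_range] at hk ⊢
        omega
      · intro k hk hk'
        simp only [Finset.mem_range] at hk hk'
        rw [(toZModPow_eq_zero_iff 2 _).mpr
          (sq_dvd_hypCoeff dβ dγ (by omega) (by omega)), zero_mul]
    have hs : Finset.range p = Finset.range (2 * N + 1) := by rw [← hN]
    simp only [map_sub, map_sum, map_mul, map_pow, map_one, map_ofNat]
    rw [hsub, hs, sub_eq_zero]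
    refine truncated_quadratic_transformation (s := φ (α * (1 - α)))
      (c := fun k => φ (hypCoeff α (1 - α) k)) (d := fun k => φ (hypCoeff β γ k))
      ?_ ?_ ?_ ?_ ?_ ?_ (φ z)
    · intro k hk
      simpa using (isUnit_padicInt_natCast (p := p) (k := k + 1) (by omega) (by omega)).map φ
    · simp [hypCoeff]
    · intro k hk
      have e := congrArg φ (hypCoeff_succ α (1 - α) (k := k) (by omega))
      simp only [map_sub, map_add, map_mul, map_pow, map_one, map_natCast] at e ⊢
      linear_combination e
    · have e := (toZModPow_eq_zero_iff 2 _).mpr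
        (sq_dvd_mul_hypCoeff dα dα' (k := 2 * N) (by omega) (by omega) (by omega))
      rw [← hφ] at e
      simp only [map_sub, map_add, map_mul, map_one, map_natCast] at e ⊢
      push_cast at e
      linear_combination e
    · intro k hk
      have e := hypCoeff_succ β γ (k := k) (by omega)
      have e' : 4 * ((k : ℤ_[p]) + 1) ^ 2 * hypCoeff β γ (k + 1) =
          (2 * k * (2 * k + 1) + α * (1 - α)) * hypCoeff β γ k := by
        rw [← hγ2, ← hβ2]
        linear_combination 4 * e + 2 * k * hypCoeff β γ k * (hβ2 + hγ2)
      simpa [map_ofNat] using congrArg φ e'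
    · have e := (toZModPow_eq_zero_iff 2 _).mpr ((sq_dvd_mul_hypCoeff dβ dγ (k := N)
        (by omega) (by omega) (by omega)).mul_left 4)
      have e' : 4 * ((β + N) * (γ + N) * hypCoeff β γ N) =
          ((2 * N) * (2 * N + 1) + α * (1 - α)) * hypCoeff β γ N := by
        rw [← hγ2, ← hβ2]
        linear_combination 2 * N * hypCoeff β γ N * (hβ2 + hγ2)
      rw [e', ← hφ] at e
      simpa [map_ofNat] using e
  have hmem : _ ∈ RingHom.ker φ := main
  rw [hφ, PadicInt.ker_toZModPow, ← PadicInt.norm_le_pow_iff_mem_span_pow, PadicInt.norm_def,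
    Nat.cast_ofNat] at hmem
  have c2 : ((2 : ℤ_[p]) : ℚ_[p]) = 2 := map_ofNat PadicInt.Coe.ringHom 2
  have c4 : ((4 : ℤ_[p]) : ℚ_[p]) = 4 := map_ofNat PadicInt.Coe.ringHom 4
  have hβc : (β : ℚ_[p]) = α / 2 := by
    rw [eq_div_iff two_ne_zero, mul_comm, ← c2, ← PadicInt.coe_mul, hβ2]
  have hγc : (γ : ℚ_[p]) = (1 - α) / 2 := by
    rw [eq_div_iff two_ne_zero, mul_comm, ← c2, ← PadicInt.coe_mul, hγ2, PadicInt.coe_sub,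
      PadicInt.coe_one]
  convert hmem using 2
  rw [PadicInt.coe_sub, PadicInt.coe_sum, PadicInt.coe_sum]
  congr 1
  · refine Finset.sum_congr rfl fun k hk => ?_
    rw [PadicInt.coe_mul, coe_hypCoeff _ _ (Finset.mem_range.mp hk)]
    simp
  · refine Finset.sum_congr rfl fun k hk => ?_
    rw [PadicInt.coe_mul, coe_hypCoeff _ _ (Finset.mem_range.mp hk), hβc, hγc]
    simp [c4]
end

section
/- Let p be an odd prime and α, z ∈ ℤ_p with ⟨−α⟩_p even. Then (∑_{k=0}^{p−1} (α/2)_k((1−α)/2)_k/(k!)² · z^k)² ≡ ∑_{k=0}^{p−1} (α)_k(1−α)_k(1/2)_k/(k!)³ · z^k (mod p²). -/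
open scoped BigOperators

section Clausen

open PowerSeries

variable {K : Type*} [Field K]

/-- The Euler operator `X · d/dX` on power series. -/
noncomputable def eulerOperator (K : Type*) [Field K] : Derivation K K⟦X⟧ K⟦X⟧ :=
  (X : K⟦X⟧) • derivative K

theorem coeff_eulerOperator (f : K⟦X⟧) (n : ℕ) :
    coeff n (eulerOperator K f) = n * coeff n f := by
  have h : eulerOperator K f = X * derivative K f := rfl
  cases n with
  | zero => simp [h]
  | succ n => rw [h, coeff_succ_X_mul, coeff_derivative]; push_cast; ring

theorem eulerOperator_X : eulerOperator K (X : K⟦X⟧) = X := by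
  have h : eulerOperator K (X : K⟦X⟧) = X * derivative K X := rfl
  simp [h]

theorem eulerOperator_C (a : K) : eulerOperator K (C a : K⟦X⟧) = 0 := by
  have h : eulerOperator K (C a : K⟦X⟧) = X * derivative K (C a) := rfl
  simp [h]

/-- The symmetric square of the hypergeometric equation with parameters `a + b = 1 / 2`,
`a * b = s` and `c = 1`. -/
theorem eulerOperator_sq_of_hypergeometric [CharZero K] (s : K) (f : K⟦X⟧)
    (hf : (1 - X) * eulerOperator K (eulerOperator K f) =
      X * (C (1 / 2) * eulerOperator K f + C s * f)) :
    (1 - X) * eulerOperator K (eulerOperator K (eulerOperator K (f ^ 2))) =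
      X * (C (3 / 2) * eulerOperator K (eulerOperator K (f ^ 2)) +
        C (4 * s + 1 / 2) * eulerOperator K (f ^ 2) + C (2 * s) * f ^ 2) := by
  have hf₁ := congrArg (eulerOperator K) hf
  have h3 : (C (3 / 2 : K) : K⟦X⟧) = 3 * C (1 / 2) := by
    rw [show (3 / 2 : K) = 3 * (1 / 2) by ring, map_mul, map_ofNat]
  have h4 : (C (4 * s + 1 / 2 : K) : K⟦X⟧) = 4 * C s + C (1 / 2) := by
    rw [map_add, map_mul, map_ofNat]
  have h2 : (C (2 * s : K) : K⟦X⟧) = 2 * C s := by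
    rw [map_mul, map_ofNat]
  have hh : 2 * (C (1 / 2 : K) : K⟦X⟧) = 1 := by
    rw [← map_ofNat (C : K →+* K⟦X⟧) 2, ← map_mul]
    simp
  rw [h3, h4, h2, sq]
  simp only [Derivation.leibniz, map_add, map_sub, smul_eq_mul, eulerOperator_X,
    eulerOperator_C, Derivation.map_one_eq_zero] at hf₁ ⊢
  generalize eulerOperator K (eulerOperator K (eulerOperator K f)) = x at *
  generalize eulerOperator K (eulerOperator K f) = w at *
  generalize eulerOperator K f = v at *
  generalize (C (1 / 2 : K) : K⟦X⟧) = c at *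
  linear_combination 6 * v * hf + 2 * f * hf₁ - 2 * X * f * w * hh

/-- Clausen's formula for the coefficient sequences of `₂F₁(a, b; 1)` with `a + b = 1 / 2`,
`a * b = s`, and of `₃F₂(2a, 2b, 1 / 2; 1, 1)`, both given by their recurrences. -/
theorem sum_antidiagonal_mul_eq_of_clausen [CharZero K] (s : K) (u v : ℕ → K)
    (hu : ∀ k : ℕ, ((k : K) + 1) ^ 2 * u (k + 1) = ((k : K) ^ 2 + k / 2 + s) * u k)
    (hv₀ : v 0 = u 0 ^ 2)
    (hv : ∀ k : ℕ, ((k : K) + 1) ^ 3 * v (k + 1) =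
      ((k : K) ^ 2 + k + 4 * s) * (k + 1 / 2) * v k) (n : ℕ) :
    ∑ x ∈ Finset.HasAntidiagonal.antidiagonal n, u x.1 * u x.2 = v n := by
  have hsq (n : ℕ) :
      coeff n (mk u ^ 2) = ∑ x ∈ Finset.HasAntidiagonal.antidiagonal n, u x.1 * u x.2 := by
    simp [sq, coeff_mul]
  have hf : (1 - X) * eulerOperator K (eulerOperator K (mk u)) =
      X * (C (1 / 2) * eulerOperator K (mk u) + C s * mk u) := by
    ext n
    cases n with
    | zero =>
      simp only [sub_mul, one_mul, map_sub, coeff_zero_X_mul, coeff_eulerOperator,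
        Nat.cast_zero, zero_mul, sub_zero]
    | succ n =>
      simp only [sub_mul, one_mul, map_sub, map_add, coeff_succ_X_mul, coeff_eulerOperator,
        coeff_C_mul, coeff_mk]
      push_cast
      linear_combination hu n
  have hg := eulerOperator_sq_of_hypergeometric s _ hf
  rw [← hsq]
  induction n with
  | zero => simp [hv₀]
  | succ n ih =>
    have h := congrArg (coeff (n + 1)) hg
    simp only [sub_mul, one_mul, map_sub, coeff_succ_X_mul, coeff_eulerOperator,
      map_add (coeff n), coeff_C_mul] at h
    push_cast at h
    rw [ih] at h
    have hn : ((n : K) + 1) ^ 3 ≠ 0 := pow_ne_zero _ (by exact_mod_cast n.succ_ne_zero)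
    apply mul_left_cancel₀ hn
    rw [hv]
    linear_combination h

end Clausen

theorem sq_sum_range_sub_sum_antidiagonal {R : Type*} [CommRing R] (n : ℕ) (u : ℕ → R) :
    (∑ k ∈ Finset.range n, u k) ^ 2
      - ∑ k ∈ Finset.range n, ∑ x ∈ Finset.HasAntidiagonal.antidiagonal k, u x.1 * u x.2 =
    ∑ x ∈ Finset.range n ×ˢ Finset.range n with n ≤ x.1 + x.2, u x.1 * u x.2 := by
  rw [sq, Finset.sum_mul_sum, ← Finset.sum_product',
    ← Finset.sum_filter_add_sum_filter_not _ (fun x : ℕ × ℕ ↦ n ≤ x.1 + x.2),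
    add_sub_assoc, add_eq_left, sub_eq_zero, Finset.sum_sigma']
  refine Finset.sum_nbij' (fun x ↦ ⟨x.1 + x.2, x⟩) (fun x ↦ x.2) ?_ ?_ ?_ ?_ ?_
  · rintro ⟨i, j⟩ h
    simp at h ⊢
    omega
  · rintro ⟨k, i, j⟩ h
    simp at h ⊢
    omega
  · intros; rfl
  · rintro ⟨k, i, j⟩ h
    simp at h ⊢
    simp [h.2]
  · intros; rfl

section Padic

variable {p : ℕ} [Fact p.Prime]

theorem poch_succ (x : ℚ_[p]) (k : ℕ) : poch p x (k + 1) = poch p x k * (x + k) :=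
  ascPochhammer_succ_eval k x

theorem norm_add_natCast_le_one {x : ℚ_[p]} (hx : ‖x‖ ≤ 1) (k : ℕ) : ‖x + k‖ ≤ 1 :=
  (Padic.nonarchimedean _ _).trans (max_le hx (by exact_mod_cast Padic.norm_int_le_one k))

theorem norm_poch_le_one {x : ℚ_[p]} (hx : ‖x‖ ≤ 1) (k : ℕ) : ‖poch p x k‖ ≤ 1 := by
  induction k with
  | zero => simp [poch]
  | succ k ih =>
    rw [poch_succ, norm_mul]
    exact mul_le_one₀ ih (norm_nonneg _) (norm_add_natCast_le_one hx k)

theorem norm_poch_le_norm_add {x : ℚ_[p]} (hx : ‖x‖ ≤ 1) {j k : ℕ} (hjk : j < k) :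
    ‖poch p x k‖ ≤ ‖x + j‖ := by
  induction k, hjk using Nat.le_induction with
  | base =>
    rw [poch_succ, norm_mul]
    exact mul_le_of_le_one_left (norm_nonneg _) (norm_poch_le_one hx j)
  | succ k _ ih =>
    rw [poch_succ, norm_mul]
    exact (mul_le_of_le_one_right (norm_nonneg _) (norm_add_natCast_le_one hx k)).trans ih

theorem norm_factorial_eq_one {k : ℕ} (hk : k < p) : ‖(k.factorial : ℚ_[p])‖ = 1 :=
  Padic.norm_natCast_eq_one_iff.2 <| (Fact.out : p.Prime).coprime_factorial_of_lt hk

theorem norm_two_eq_one (hp : Odd p) : ‖(2 : ℚ_[p])‖ = 1 := by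
  have h := (Padic.norm_natCast_eq_one_iff (p := p) (n := 2)).2 hp.coprime_two_right
  exact_mod_cast h

theorem norm_add_res_neg_le (α : ℤ_[p]) : ‖(α : ℚ_[p]) + res p (-α)‖ ≤ (p : ℝ)⁻¹ := by
  have h : PadicInt.toZMod (α + (res p (-α) : ℤ_[p])) = 0 := by
    rw [map_add, map_natCast, res, ZMod.natCast_zmod_val, map_neg, add_neg_cancel]
  rw [← RingHom.mem_ker, PadicInt.ker_toZMod, PadicInt.maximalIdeal_eq_span_p,
    ← pow_one (p : ℤ_[p]), ← PadicInt.norm_le_pow_iff_mem_span_pow] at h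
  simpa [PadicInt.norm_def] using h

/-- Past the middle of the range, one factor of each of the two Pochhammer symbols is divisible
by `p`. -/
theorem norm_poch_half_mul_poch_half_le (hp : Odd p) (α : ℤ_[p]) (hα : Even (res p (-α)))
    {k : ℕ} (hk : p ≤ 2 * k) :
    ‖poch p ((α : ℚ_[p]) / 2) k * poch p ((1 - (α : ℚ_[p])) / 2) k‖ ≤ (p : ℝ) ^ (-2 : ℤ) := by
  have h2 := norm_two_eq_one hp
  have hα₁ : ‖(α : ℚ_[p]) / 2‖ ≤ 1 := by
    rw [norm_div, h2, div_one]; exact α.norm_le_one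
  have hα₂ : ‖(1 - (α : ℚ_[p])) / 2‖ ≤ 1 := by
    rw [norm_div, h2, div_one]; exact_mod_cast (1 - α).norm_le_one
  have hlt : res p (-α) < p := ZMod.val_lt _
  have hres := norm_add_res_neg_le α
  obtain ⟨m, hm⟩ := hα
  obtain ⟨l, hl⟩ := hp
  rw [hm] at hlt hres
  have hA : ‖(α : ℚ_[p]) / 2 + m‖ ≤ (p : ℝ)⁻¹ := by
    rw [show (α : ℚ_[p]) / 2 + m = (α + ((m + m : ℕ) : ℚ_[p])) / 2 by push_cast; ring,
      norm_div, h2, div_one]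
    exact hres
  have hB : ‖(1 - (α : ℚ_[p])) / 2 + (l - m : ℕ)‖ ≤ (p : ℝ)⁻¹ := by
    have hpl : (p : ℚ_[p]) = 2 * l + 1 := by exact_mod_cast hl
    rw [show (1 - (α : ℚ_[p])) / 2 + (l - m : ℕ) = (p - (α + ((m + m : ℕ) : ℚ_[p]))) / 2 by
        rw [hpl, Nat.cast_sub (by omega)]; push_cast; ring,
      norm_div, h2, div_one, sub_eq_add_neg]
    refine (Padic.nonarchimedean _ _).trans (max_le ?_ ?_)
    · rw [Padic.norm_p]
    · rwa [norm_neg]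
  rw [norm_mul, zpow_neg, zpow_ofNat, ← inv_pow, sq]
  exact mul_le_mul ((norm_poch_le_norm_add hα₁ (by omega)).trans hA)
    ((norm_poch_le_norm_add hα₂ (by omega)).trans hB) (norm_nonneg _) (by positivity)

theorem sum_antidiagonal_poch_half (α : ℚ_[p]) (n : ℕ) :
    ∑ x ∈ Finset.HasAntidiagonal.antidiagonal n,
      (poch p (α / 2) x.1 * poch p ((1 - α) / 2) x.1 / (Nat.factorial x.1 : ℚ_[p]) ^ 2) *
      (poch p (α / 2) x.2 * poch p ((1 - α) / 2) x.2 / (Nat.factorial x.2 : ℚ_[p]) ^ 2) =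
    poch p α n * poch p (1 - α) n * poch p (1 / 2) n / (Nat.factorial n : ℚ_[p]) ^ 3 := by
  refine sum_antidiagonal_mul_eq_of_clausen (α / 2 * ((1 - α) / 2))
    (fun k ↦ poch p (α / 2) k * poch p ((1 - α) / 2) k / (Nat.factorial k : ℚ_[p]) ^ 2)
    (fun k ↦ poch p α k * poch p (1 - α) k * poch p (1 / 2) k / (Nat.factorial k : ℚ_[p]) ^ 3)
    (fun k ↦ ?_) ?_ (fun k ↦ ?_) n
  · have h₁ : (k : ℚ_[p]) + 1 ≠ 0 := by exact_mod_cast k.succ_ne_zero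
    have h₂ : (Nat.factorial k : ℚ_[p]) ≠ 0 := by exact_mod_cast k.factorial_ne_zero
    simp only [poch_succ, Nat.factorial_succ]
    push_cast
    field_simp
    ring
  · simp [poch]
  · have h₁ : (k : ℚ_[p]) + 1 ≠ 0 := by exact_mod_cast k.succ_ne_zero
    have h₂ : (Nat.factorial k : ℚ_[p]) ≠ 0 := by exact_mod_cast k.factorial_ne_zero
    simp only [poch_succ, Nat.factorial_succ]
    push_cast
    field_simp
    ring

end Padic

/-- Corollary of the p-adic quadratic transformation and p-adic Clausen identity. -/
theorem padic_clausen_half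
    (p : ℕ) [Fact p.Prime] (hp : Odd p) (α z : ℤ_[p]) (hα : Even (res p (-α))) :
    ‖(∑ k ∈ Finset.range p,
        poch p ((α : ℚ_[p]) / 2) k * poch p ((1 - (α : ℚ_[p])) / 2) k / (Nat.factorial k : ℚ_[p]) ^ 2
          * (z : ℚ_[p]) ^ k) ^ 2
      - ∑ k ∈ Finset.range p,
          poch p (α : ℚ_[p]) k * poch p (1 - (α : ℚ_[p])) k * poch p ((1 : ℚ_[p]) / 2) k
            / (Nat.factorial k : ℚ_[p]) ^ 3 * (z : ℚ_[p]) ^ k‖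
      ≤ (p : ℝ) ^ (-2 : ℤ) := by
  have h2 := norm_two_eq_one hp
  have hα₁ : ‖(α : ℚ_[p]) / 2‖ ≤ 1 := by
    rw [norm_div, h2, div_one]; exact α.norm_le_one
  have hα₂ : ‖(1 - (α : ℚ_[p])) / 2‖ ≤ 1 := by
    rw [norm_div, h2, div_one]; exact_mod_cast (1 - α).norm_le_one
  set u : ℕ → ℚ_[p] := fun k ↦
    poch p ((α : ℚ_[p]) / 2) k * poch p ((1 - (α : ℚ_[p])) / 2) k / (Nat.factorial k : ℚ_[p]) ^ 2
      * (z : ℚ_[p]) ^ k with hu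
  have hz (k : ℕ) : ‖(z : ℚ_[p]) ^ k‖ ≤ 1 := by
    rw [norm_pow]; exact pow_le_one₀ (norm_nonneg _) z.norm_le_one
  have hnorm {k : ℕ} (hk : k < p) :
      ‖u k‖ ≤ ‖poch p ((α : ℚ_[p]) / 2) k * poch p ((1 - (α : ℚ_[p])) / 2) k‖ := by
    rw [hu, norm_mul, norm_div, norm_pow, norm_factorial_eq_one hk, one_pow, div_one]
    exact mul_le_of_le_one_right (norm_nonneg _) (hz k)
  have hle {k : ℕ} (hk : k < p) : ‖u k‖ ≤ 1 := by
    refine (hnorm hk).trans ?_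
    rw [norm_mul]
    exact mul_le_one₀ (norm_poch_le_one hα₁ k) (norm_nonneg _) (norm_poch_le_one hα₂ k)
  have hsmall {k : ℕ} (hk : k < p) (hk₂ : p ≤ 2 * k) : ‖u k‖ ≤ (p : ℝ) ^ (-2 : ℤ) :=
    (hnorm hk).trans (norm_poch_half_mul_poch_half_le hp α hα hk₂)
  have hconv (k : ℕ) :
      poch p (α : ℚ_[p]) k * poch p (1 - (α : ℚ_[p])) k * poch p ((1 : ℚ_[p]) / 2) k
        / (Nat.factorial k : ℚ_[p]) ^ 3 * (z : ℚ_[p]) ^ k =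
      ∑ x ∈ Finset.HasAntidiagonal.antidiagonal k, u x.1 * u x.2 := by
    rw [← sum_antidiagonal_poch_half, Finset.sum_mul]
    refine Finset.sum_congr rfl fun x hx ↦ ?_
    rw [← Finset.HasAntidiagonal.mem_antidiagonal.1 hx, pow_add, hu]
    ring
  rw [Finset.sum_congr rfl fun k _ ↦ hconv k, sq_sum_range_sub_sum_antidiagonal]
  refine IsUltrametricDist.norm_sum_le_of_forall_le_of_nonneg (by positivity) ?_
  rintro ⟨i, j⟩ hij
  simp only [Finset.mem_filter, Finset.mem_product, Finset.mem_range] at hij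
  obtain ⟨⟨hi, hj⟩, hij⟩ := hij
  rw [norm_mul]
  rcases le_total i j with h | h
  · exact (mul_le_of_le_one_left (norm_nonneg _) (hle hi)).trans (hsmall hj (by omega))
  · exact (mul_le_of_le_one_right (norm_nonneg _) (hle hj)).trans (hsmall hi (by omega))
end

section
/- Let p be an odd prime, α ∈ ℤ_p with ⟨−α⟩_p even, and z ∈ ℤ_p^× with z − 1 ∈ ℤ_p^×. Set λ = λ_p^{(2)}(α). Then ∑_{k=0}^{p−1} (α)_k²/(k!)² · z^k − z^{1−λ} · ∑_{k=0}^{p−1} (α)_k²/(k!)² · z^{−k} ≡ (1−z)^{1−λ} · ∑_{k=0}^{p−1} (α/2)_k((1−α)/2)_k/(k!)² · (−4z/(1−z)²)^k (mod p²). -/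
open scoped BigOperators

/-- The least non-negative residue `⟨α⟩_{p²} ∈ {0,…,p²-1}` of `α ∈ ℤ_[p]` modulo `p²`. -/
noncomputable def res2 (p : ℕ) [Fact p.Prime] (α : ℤ_[p]) : ℕ :=
  (PadicInt.toZModPow 2 α).val

/-- `λ_p^{(2)}(α) = ((⟨−α⟩_p − ⟨−α⟩_{p²})/p)·(p−1) − ⟨−α⟩_p`, an integer congruent mod `p²`
to the exponent `λ_p(α)` of the paper on units. -/
noncomputable def lam2 (p : ℕ) [Fact p.Prime] (α : ℤ_[p]) : ℤ :=
  (((res p (-α) : ℤ) - (res2 p (-α) : ℤ)) / (p : ℤ)) * ((p : ℤ) - 1) - (res p (-α) : ℤ)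

section TruncatedQuadratic

open Polynomial

variable {R : Type*} [CommRing R]

theorem isUnit_natCast_of_coprime_of_sq_eq_zero {p k : ℕ} (hp : (p : R) ^ 2 = 0)
    (hk : k.Coprime p) : IsUnit (k : R) := by
  have h : IsCoprime (k : ℤ) ((p : ℤ) ^ 2) := (Nat.isCoprime_iff_coprime.2 hk).pow_right
  obtain ⟨x, y, hxy⟩ := h
  refine IsUnit.of_mul_eq_one (x : R) ?_
  have := congrArg (Int.cast : ℤ → R) hxy
  push_cast at this
  rw [hp] at this
  linear_combination this

theorem one_add_pow_of_sq_eq_zero {x : R} (hx : x ^ 2 = 0) (m : ℕ) :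
    (1 + x) ^ m = 1 + m * x := by
  induction m with
  | zero => simp
  | succ m ih =>
    rw [pow_succ, ih]
    push_cast
    linear_combination (m : R) * hx

/-- The Euler operator `X · d/dX`. -/
noncomputable def euler (f : R[X]) : R[X] := X * derivative f

/-- The differential operator annihilating `∑ (n choose k)² X ^ k`. -/
noncomputable def legendreOp (n : ℕ) (f : R[X]) : R[X] :=
  euler (euler f) - X * (euler (euler f) - 2 * (n : R[X]) * euler f + (n : R[X]) ^ 2 * f)

theorem coeff_euler (f : R[X]) (j : ℕ) : (euler f).coeff j = j * f.coeff j := by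
  cases j with
  | zero => simp [euler]
  | succ j => simp [euler, coeff_X_mul, coeff_derivative, mul_comm]

theorem coeff_legendreOp_succ (n : ℕ) (f : R[X]) (j : ℕ) :
    (legendreOp n f).coeff (j + 1) =
      (j + 1) ^ 2 * f.coeff (j + 1) - ((n : R) - j) ^ 2 * f.coeff j := by
  have h : euler (euler f) - 2 * (n : R[X]) * euler f + (n : R[X]) ^ 2 * f =
      euler (euler f) - C (2 * (n : R)) * euler f + C ((n : R) ^ 2) * f := by
    simp [map_ofNat C]
  rw [legendreOp, h]
  simp only [coeff_sub, coeff_X_mul, coeff_add, coeff_C_mul, coeff_euler]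
  push_cast
  ring

theorem euler_sum_C_mul {ι : Type*} (s : Finset ι) (e : ι → R) (f : ι → R[X]) :
    euler (∑ i ∈ s, C (e i) * f i) = ∑ i ∈ s, C (e i) * euler (f i) := by
  simp only [euler, derivative_sum, derivative_C_mul, Finset.mul_sum, mul_left_comm]

theorem legendreOp_sum_C_mul {ι : Type*} (n : ℕ) (s : Finset ι) (e : ι → R) (f : ι → R[X]) :
    legendreOp n (∑ i ∈ s, C (e i) * f i) = ∑ i ∈ s, C (e i) * legendreOp n (f i) := by
  simp only [legendreOp, euler_sum_C_mul, Finset.mul_sum, ← Finset.sum_sub_distrib,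
    ← Finset.sum_add_distrib]
  refine Finset.sum_congr rfl fun i _ ↦ ?_
  ring

theorem euler_mul (f g : R[X]) : euler (f * g) = euler f * g + f * euler g := by
  simp only [euler, derivative_mul]; ring

theorem euler_X_pow (k : ℕ) : euler (X ^ k : R[X]) = (k : R[X]) * X ^ k := by
  cases k with
  | zero => simp [euler]
  | succ k => simp [euler]; ring

theorem euler_one_sub_X_pow (m : ℕ) :
    euler ((1 - X) ^ (m + 1) : R[X]) = -((m : R[X]) + 1) * X * (1 - X) ^ m := by
  simp [euler, derivative_pow]; ring

theorem legendreOp_X_pow_mul_one_sub_X_pow {n k m : ℕ} (h : n = m + 2 + 2 * k) :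
    legendreOp n (X ^ k * (1 - X) ^ (m + 2) : R[X]) =
      (1 - X) * ((k : R[X]) ^ 2 * (X ^ k * (1 - X) ^ (m + 2)) -
        ((n : R[X]) - 2 * (k : R[X])) * ((n : R[X]) + 2 * (k : R[X]) + 1) * (X ^ (k + 1) * (1 - X) ^ m)) := by
  have h1 : euler (X ^ k * (1 - X) ^ (m + 2) : R[X]) =
      (k : R[X]) * (X ^ k * (1 - X) ^ (m + 2)) -
        ((m : R[X]) + 2) * (X ^ (k + 1) * (1 - X) ^ (m + 1)) := by
    rw [euler_mul, euler_X_pow, euler_one_sub_X_pow]; push_cast; ring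
  have h2 : euler (euler (X ^ k * (1 - X) ^ (m + 2) : R[X])) =
      (k : R[X]) * euler (X ^ k * (1 - X) ^ (m + 2)) -
        ((m : R[X]) + 2) * (((k : R[X]) + 1) * X ^ (k + 1) * (1 - X) ^ (m + 1) -
          X ^ (k + 1) * ((m : R[X]) + 1) * X * (1 - X) ^ m) := by
    conv_lhs => rw [h1]
    have h3 (f g : R[X]) (i j : ℕ) : euler ((i : R[X]) * f - ((j : R[X]) + 2) * g) =
        (i : R[X]) * euler f - ((j : R[X]) + 2) * euler g := by
      simp only [euler, derivative_sub, derivative_mul, derivative_add, derivative_natCast,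
        derivative_ofNat]
      ring
    rw [h3, euler_mul (X ^ (k + 1)), euler_X_pow, euler_one_sub_X_pow]
    push_cast; ring
  have hn : (n : R[X]) = m + 2 + 2 * k := by rw [h]; push_cast; ring
  rw [legendreOp, h2, h1, hn]
  ring

/-- Antipalindromic polynomials are determined by the lower half of their coefficients. -/
theorem eq_sub_reflect {p : ℕ} (hp : 0 < p) {P Q : R[X]} (hP : P.natDegree < p)
    (hQ : Q.natDegree < 2 * p) (hQr : reflect (2 * p - 1) Q = -Q)
    (h : ∀ i < p, Q.coeff i = P.coeff i) : Q = P - reflect (2 * p - 1) P := by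
  ext i
  rw [coeff_sub, coeff_reflect]
  rcases lt_or_ge i (2 * p) with hi | hi
  · rw [revAt_le (by omega)]
    rcases lt_or_ge i p with hip | hip
    · rw [h i hip, P.coeff_eq_zero_of_natDegree_lt (n := 2 * p - 1 - i) (by omega), sub_zero]
    · have := congrArg (coeff · i) hQr
      simp only [coeff_reflect, coeff_neg] at this
      rw [revAt_le (by omega), h _ (by omega)] at this
      rw [P.coeff_eq_zero_of_natDegree_lt (n := i) (by omega), this]
      ring
  · rw [revAt_eq_self_of_lt (by omega), Q.coeff_eq_zero_of_natDegree_lt (by omega), sub_self]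

theorem eval_reflect (u : Rˣ) {d : ℕ} {f : R[X]} (hf : f.natDegree ≤ d) :
    (reflect d f).eval (u : R) = u ^ d * f.eval ((u⁻¹ : Rˣ) : R) := by
  let _ := (u⁻¹).invertible
  have := eval₂_reflect_mul_pow (RingHom.id R) ((u⁻¹ : Rˣ) : R) d f hf
  simp only [invOf_units, inv_inv, eval₂_id] at this
  rw [← this, mul_left_comm, ← mul_pow, Units.mul_inv, one_pow, mul_one]

theorem isUnit_factorial_of_sq_eq_zero {p k : ℕ} [hp : Fact p.Prime] (hpp : (p : R) ^ 2 = 0)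
    (hk : k < p) : IsUnit (k.factorial : R) :=
  isUnit_natCast_of_coprime_of_sq_eq_zero hpp
    ((hp.1.coprime_iff_not_dvd.2 fun h ↦ by
      have := (hp.1.dvd_factorial).1 h
      omega).symm)

/-- The quadratic transformation for Legendre polynomials, at the level of coefficients
of degree less than `p`. -/
theorem coeff_sum_quadratic {p s n : ℕ} [hp : Fact p.Prime] (hs : p = 2 * s + 1)
    (hpp : (p : R) ^ 2 = 0) (hn : p < n) {c e : ℕ → R}
    (hc : ∀ k < p, (k.factorial : R) ^ 2 * c k = (∏ j ∈ Finset.range k, ((n : R) - j)) ^ 2)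
    (he : ∀ k < p, (k.factorial : R) ^ 2 * e k =
      (∏ j ∈ Finset.range k, ((n : R) - 2 * j)) * ∏ j ∈ Finset.range k, ((n : R) + 2 * j + 1))
    (hes : ((n : R) - 2 * s) * ((n : R) + 2 * s + 1) * e s = 0) {j : ℕ} (hj : j < p) :
    (∑ k ∈ Finset.range (s + 1),
      C (e k) * (X ^ k * (1 - X) ^ (n - 2 * k) : R[X])).coeff j = c j := by
  have hL : legendreOp n (∑ k ∈ Finset.range (s + 1),
      C (e k) * (X ^ k * (1 - X) ^ (n - 2 * k) : R[X])) = 0 := by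
    rw [legendreOp_sum_C_mul]
    have key : ∀ r ≤ s, ∑ k ∈ Finset.range (r + 1),
        C (e k) * legendreOp n (X ^ k * (1 - X) ^ (n - 2 * k) : R[X]) =
        - (C (((n : R) - 2 * r) * ((n : R) + 2 * r + 1) * e r) *
          ((1 - X) * (X ^ (r + 1) * (1 - X) ^ (n - 2 * r - 2)))) := by
      intro r hr
      induction r with
      | zero =>
        obtain ⟨m, hm⟩ : ∃ m, n = m + 2 := ⟨n - 2, by omega⟩
        have hmm : n - 2 * 0 = m + 2 := by omega
        have := legendreOp_X_pow_mul_one_sub_X_pow (R := R) (n := n) (k := 0) (m := m) (by omega)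
        rw [Finset.sum_range_one, hmm, this]
        simp
        ring
      | succ r ih =>
        obtain ⟨m, hm⟩ : ∃ m, n = m + 2 + 2 * (r + 1) := ⟨n - 2 - 2 * (r + 1), by omega⟩
        have hmm : n - 2 * (r + 1) = m + 2 := by omega
        have hm1 : n - 2 * r - 2 = m + 2 := by omega
        have := legendreOp_X_pow_mul_one_sub_X_pow (R := R) (n := n) (k := r + 1) (m := m) hm
        have hrec : ((r : R) + 1) ^ 2 * e (r + 1) =
            ((n : R) - 2 * r) * ((n : R) + 2 * r + 1) * e r := by
          have hu := (isUnit_factorial_of_sq_eq_zero (k := r) hpp (by omega)).pow 2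
          refine hu.mul_left_cancel ?_
          have h1 := he (r + 1) (by omega)
          have h2 := he r (by omega)
          rw [Finset.prod_range_succ, Finset.prod_range_succ, Nat.factorial_succ] at h1
          push_cast at h1
          linear_combination h1 - ((n : R) - 2 * r) * ((n : R) + 2 * r + 1) * h2
        rw [Finset.sum_range_succ, ih (by omega), hmm, hm1, this, ← hrec, Nat.add_sub_cancel]
        simp only [map_mul, map_sub, map_add, map_natCast, map_pow, map_one, map_ofNat]
        push_cast
        ring
    rw [key s le_rfl, hes]
    simp
  induction j with
  | zero =>
    have h1 := hc 0 hj
    have h2 := he 0 hj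
    simp only [Nat.factorial_zero, Nat.cast_one, one_pow, one_mul, Finset.prod_range_zero,
      mul_one] at h1 h2
    rw [h1, finsetSum_coeff, Finset.sum_range_succ', Finset.sum_eq_zero]
    · simp [h2, coeff_zero_eq_eval_zero]
    · intro k _
      simp [coeff_zero_eq_eval_zero]
  | succ j ih =>
    have h := coeff_legendreOp_succ n (∑ k ∈ Finset.range (s + 1),
      C (e k) * (X ^ k * (1 - X) ^ (n - 2 * k) : R[X])) j
    rw [hL, coeff_zero, ih (by omega)] at h
    have hu := (isUnit_factorial_of_sq_eq_zero (k := j + 1) hpp hj).pow 2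
    refine hu.mul_left_cancel ?_
    have h1 := hc (j + 1) hj
    have h2 := hc j (by omega)
    rw [h1, Finset.prod_range_succ, Nat.factorial_succ]
    push_cast
    linear_combination -(j.factorial : R) ^ 2 * h + ((n : R) - j) ^ 2 * h2

theorem reflect_one_sub_X_pow (m : ℕ) :
    reflect m ((1 - X) ^ m : R[X]) = (-1) ^ m * (1 - X) ^ m := by
  have hd : (1 - X : R[X]).natDegree ≤ 1 := by
    refine (natDegree_sub_le _ _).trans ?_
    simp [natDegree_X_le]
  induction m with
  | zero => simp [reflect_one]
  | succ m ih =>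
    have h1 : reflect 1 (1 - X : R[X]) = X - 1 := by
      have := reflect_monomial (R := R) 1 1
      rw [pow_one, revAt_le le_rfl] at this
      rw [reflect_sub, this, ← C_1, reflect_C]; simp
    rw [pow_succ, reflect_mul _ _ (natDegree_pow_le_of_le m hd |>.trans (by simp)) hd, ih, h1]
    ring

theorem natDegree_one_sub_X_pow_le (m : ℕ) : ((1 - X) ^ m : R[X]).natDegree ≤ m := by
  have hd : (1 - X : R[X]).natDegree ≤ 1 := by
    refine (natDegree_sub_le _ _).trans ?_
    simp [natDegree_X_le]
  simpa using natDegree_pow_le_of_le m hd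

theorem reflect_finset_sum {ι : Type*} (N : ℕ) (s : Finset ι) (f : ι → R[X]) :
    reflect N (∑ i ∈ s, f i) = ∑ i ∈ s, reflect N (f i) := by
  classical
  induction s using Finset.induction_on with
  | empty => simp
  | insert i s hi ih => rw [Finset.sum_insert hi, Finset.sum_insert hi, reflect_add, ih]

theorem natDegree_quadratic_term_le {s k : ℕ} (hk : k ≤ s) :
    (X ^ k * (1 - X) ^ (2 * s - 2 * k) : R[X]).natDegree ≤ 2 * s := by
  refine natDegree_mul_le_of_le (natDegree_X_pow_le k) (natDegree_one_sub_X_pow_le _) |>.trans ?_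
  omega

theorem reflect_quadratic_sum (s : ℕ) (e : ℕ → R) :
    reflect (2 * s) (∑ k ∈ Finset.range (s + 1),
      C (e k) * (X ^ k * (1 - X) ^ (2 * s - 2 * k) : R[X])) =
    ∑ k ∈ Finset.range (s + 1), C (e k) * (X ^ k * (1 - X) ^ (2 * s - 2 * k)) := by
  rw [reflect_finset_sum]
  refine Finset.sum_congr rfl fun k hk ↦ ?_
  have hk : k ≤ s := Nat.lt_succ_iff.1 (Finset.mem_range.1 hk)
  rw [reflect_C_mul]
  congr 1
  have h : 2 * s = 2 * k + (2 * s - 2 * k) := by omega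
  have he : Even (2 * s - 2 * k) := ⟨s - k, by omega⟩
  conv_lhs => rw [h]
  rw [Nat.add_sub_cancel_left, reflect_mul _ _ ((natDegree_X_pow_le k).trans (by omega))
    (natDegree_one_sub_X_pow_le _), reflect_one_sub_X_pow, reflect_monomial,
    revAt_le (by omega), he.neg_one_pow, one_mul]
  congr 2
  omega

theorem natDegree_quadratic_sum_le (s : ℕ) (e : ℕ → R) :
    (∑ k ∈ Finset.range (s + 1),
      C (e k) * (X ^ k * (1 - X) ^ (2 * s - 2 * k) : R[X])).natDegree ≤ 2 * s := by
  refine natDegree_sum_le_of_forall_le _ _ fun k hk ↦ (natDegree_C_mul_le _ _).trans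
    (natDegree_quadratic_term_le (Nat.lt_succ_iff.1 (Finset.mem_range.1 hk)))

theorem prod_mul_prod_eq_zero {p s a t n : ℕ} (hs : p = 2 * s + 1) (hpp : (p : R) ^ 2 = 0)
    (ha : Even a) (hap : a < p) (hn : n = a + p * t) {k : ℕ} (hk : s < k) :
    (∏ j ∈ Finset.range k, ((n : R) - 2 * j)) * ∏ j ∈ Finset.range k, ((n : R) + 2 * j + 1) =
      0 := by
  obtain ⟨b, rfl⟩ := ha
  have h1 : (p : R) ∣ ∏ j ∈ Finset.range k, ((n : R) - 2 * j) := by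
    refine Dvd.dvd.trans ?_ (Finset.dvd_prod_of_mem _ (Finset.mem_range.2 (show b < k by omega)))
    refine ⟨t, ?_⟩
    rw [hn]; push_cast; ring
  have h2 : (p : R) ∣ ∏ j ∈ Finset.range k, ((n : R) + 2 * j + 1) := by
    refine Dvd.dvd.trans ?_
      (Finset.dvd_prod_of_mem _ (Finset.mem_range.2 (show s - b < k by omega)))
    refine ⟨t + 1, ?_⟩
    have : ((s - b : ℕ) : R) = s - b := Nat.cast_sub (by omega)
    rw [hn, this, hs]; push_cast; ring
  obtain ⟨x, hx⟩ := h1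
  obtain ⟨y, hy⟩ := h2
  rw [hx, hy]
  linear_combination x * y * hpp

theorem exists_one_sub_X_pow_prime {p : ℕ} [hp : Fact p.Prime] (hodd : Odd p) :
    ∃ r : R[X], (1 - X) ^ p - 1 + X ^ p = (p : R[X]) * r := by
  obtain ⟨r, hr⟩ := exists_add_pow_prime_eq hp.1 (1 : R[X]) (-X)
  refine ⟨-X * r, ?_⟩
  rw [hodd.neg_pow, ← sub_eq_add_neg] at hr
  rw [hr]
  ring

theorem reflect_one_sub_X_pow_sub_one_add_X_pow {p : ℕ} (hodd : Odd p) :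
    reflect p ((1 - X) ^ p - 1 + X ^ p : R[X]) = -((1 - X) ^ p - 1 + X ^ p) := by
  rw [reflect_add, reflect_sub, reflect_one_sub_X_pow, reflect_one, reflect_monomial,
    revAt_le le_rfl, hodd.neg_one_pow, Nat.sub_self]
  ring

/-- Expansion of `(1 - X) ^ (p * t)` modulo `p ^ 2` and `X ^ p`. -/
theorem X_pow_dvd_one_sub_X_pow_mul {p : ℕ} [Fact p.Prime] (hodd : Odd p)
    (hpp : (p : R) ^ 2 = 0) (t : ℕ) :
    (X ^ p : R[X]) ∣ (1 - X) ^ (p * t) - (1 + (t : R[X]) * ((1 - X) ^ p - 1 + X ^ p)) := by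
  obtain ⟨r, hr⟩ := exists_one_sub_X_pow_prime (R := R) (p := p) hodd
  have hpp' : (p : R[X]) ^ 2 = 0 := by
    have := congrArg C hpp
    simpa using this
  rw [← one_add_pow_of_sq_eq_zero (x := (1 - X) ^ p - 1 + X ^ p)
    (by rw [hr, mul_pow, hpp', zero_mul]), pow_mul]
  refine Dvd.dvd.trans ?_ (sub_dvd_pow_sub_pow _ _ t)
  exact ⟨-1, by ring⟩

theorem sum_range_eq_of_le {M : Type*} [AddCommMonoid M] {f : ℕ → M} {m n : ℕ} (h : m ≤ n)
    (hf : ∀ k, m ≤ k → k < n → f k = 0) :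
    ∑ k ∈ Finset.range n, f k = ∑ k ∈ Finset.range m, f k :=
  (Finset.sum_subset (Finset.range_mono h) fun k hk hk' ↦
    hf k (by simpa using hk') (by simpa using hk)).symm

theorem quadratic_transformation_of_sq_eq_zero {p s a t n : ℕ} [hp : Fact p.Prime]
    (hs : p = 2 * s + 1) (hpp : (p : R) ^ 2 = 0) (ha : Even a) (hap : a < p)
    (hn : n = a + p * t) (hpn : p < n) {c e : ℕ → R}
    (hc : ∀ k < p, (k.factorial : R) ^ 2 * c k = (∏ j ∈ Finset.range k, ((n : R) - j)) ^ 2)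
    (he : ∀ k < p, (k.factorial : R) ^ 2 * e k =
      (∏ j ∈ Finset.range k, ((n : R) - 2 * j)) * ∏ j ∈ Finset.range k, ((n : R) + 2 * j + 1))
    {u v : Rˣ} (huv : (v : R) = 1 - u) (hu : (p : R) ∣ (u : R) ^ (p - 1) - 1) :
    ∑ k ∈ Finset.range p, c k * (u : R) ^ k
      - u * (1 + t * ((u : R) ^ (p - 1) - 1)) * (u ^ a *
        ∑ k ∈ Finset.range p, c k * ((u⁻¹ : Rˣ) : R) ^ k) =
    v * (1 + t * ((v : R) ^ (p - 1) - 1)) * (v ^ a *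
      ∑ k ∈ Finset.range p, e k * (u * ((v⁻¹ : Rˣ) : R) ^ 2) ^ k) := by
  have hodd : Odd p := ⟨s, hs⟩
  have hcz : ∀ k, a + 1 ≤ k → k < p → c k = 0 := by
    intro k hk hkp
    refine ((isUnit_factorial_of_sq_eq_zero hpp hkp).pow 2).mul_left_cancel ?_
    rw [hc k hkp, mul_zero]
    have h1 : (p : R) ∣ ∏ j ∈ Finset.range k, ((n : R) - j) := by
      refine Dvd.dvd.trans ?_ (Finset.dvd_prod_of_mem _ (Finset.mem_range.2 hk))
      exact ⟨t, by rw [hn]; push_cast; ring⟩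
    obtain ⟨x, hx⟩ := h1
    rw [hx, mul_pow, hpp, zero_mul]
  have hez : ∀ k, s + 1 ≤ k → k < p → e k = 0 := by
    intro k hk hkp
    refine ((isUnit_factorial_of_sq_eq_zero hpp hkp).pow 2).mul_left_cancel ?_
    rw [he k hkp, mul_zero, prod_mul_prod_eq_zero hs hpp ha hap hn hk]
  have hes : ((n : R) - 2 * s) * ((n : R) + 2 * s + 1) * e s = 0 := by
    refine ((isUnit_factorial_of_sq_eq_zero (k := s) hpp (by omega)).pow 2).mul_left_cancel ?_
    have h1 := prod_mul_prod_eq_zero (R := R) hs hpp ha hap hn (Nat.lt_succ_self s)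
    have h2 := he s (by omega)
    rw [Finset.prod_range_succ, Finset.prod_range_succ] at h1
    linear_combination h1 + ((n : R) - 2 * s) * ((n : R) + 2 * s + 1) * h2
  have hNe : Even (2 * s - a) := by
    obtain ⟨b, rfl⟩ := ha
    exact ⟨s - b, by omega⟩
  -- the polynomials involved
  set f : R[X] := ∑ k ∈ Finset.range (a + 1), C (c k) * X ^ k with hf
  set G : R[X] := ∑ k ∈ Finset.range (s + 1),
    C (e k) * (X ^ k * (1 - X) ^ (2 * s - 2 * k)) with hG
  set E : R[X] := (1 - X) ^ p - 1 + X ^ p with hE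
  set P : R[X] := (1 - X) ^ (2 * s - a) * f - G with hP
  have hGd : G.natDegree ≤ 2 * s := natDegree_quadratic_sum_le s e
  have hfd : f.natDegree ≤ a := natDegree_sum_le_of_forall_le _ _ fun k hk ↦
    (natDegree_C_mul_X_pow_le _ _).trans (by have := Finset.mem_range.1 hk; omega)
  have hPd : P.natDegree ≤ 2 * s := by
    refine (natDegree_sub_le _ _).trans (max_le ?_ hGd)
    refine (natDegree_mul_le_of_le (natDegree_one_sub_X_pow_le _) hfd).trans (by omega)
  have hEd : E.natDegree ≤ p := by
    refine (natDegree_add_le _ _).trans (max_le ((natDegree_sub_le _ _).trans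
      (max_le (natDegree_one_sub_X_pow_le _) (by simp))) (natDegree_X_pow_le _))
  have hfX : (X ^ p : R[X]) ∣ (1 - X) ^ (n - 2 * s) * G - f := by
    rw [X_pow_dvd_iff]
    intro j hj
    have h1 := coeff_sum_quadratic hs hpp hpn hc he hes hj
    have h2 : (1 - X) ^ (n - 2 * s) * G = ∑ k ∈ Finset.range (s + 1),
        C (e k) * (X ^ k * (1 - X) ^ (n - 2 * k) : R[X]) := by
      rw [hG, Finset.mul_sum]
      refine Finset.sum_congr rfl fun k hk ↦ ?_
      have hk : k ≤ s := Nat.lt_succ_iff.1 (Finset.mem_range.1 hk)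
      rw [show n - 2 * k = (n - 2 * s) + (2 * s - 2 * k) by omega, pow_add]
      ring
    have h3 : f.coeff j = c j := by
      rw [hf, finsetSum_coeff]
      simp only [coeff_C_mul_X_pow]
      rw [Finset.sum_ite_eq]
      split_ifs with h
      · rfl
      · exact (hcz j (by simpa using h) hj).symm
    rw [coeff_sub, h2, h1, h3, sub_self]
  have hPX : (X ^ p : R[X]) ∣ (t : R[X]) * E * G - P := by
    obtain ⟨x, hx⟩ := hfX
    obtain ⟨y, hy⟩ := X_pow_dvd_one_sub_X_pow_mul (R := R) (p := p) hodd hpp t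
    have h4 : (1 - X : R[X]) ^ (p * t) = (1 - X) ^ (2 * s - a) * (1 - X) ^ (n - 2 * s) := by
      rw [← pow_add]
      congr 1
      omega
    rw [h4] at hy
    refine ⟨(1 - X) ^ (2 * s - a) * x - y * G, ?_⟩
    rw [hP]
    linear_combination (1 - X) ^ (2 * s - a) * hx - G * hy
  have hQP : (t : R[X]) * E * G = P - reflect (2 * p - 1) P := by
    refine eq_sub_reflect hp.1.pos (by omega) ?_ ?_ ?_
    · have h5 : ((t : R[X]) * E).natDegree ≤ p := by
        rw [← C_eq_natCast]; exact (natDegree_C_mul_le _ _).trans hEd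
      have := natDegree_mul_le_of_le h5 hGd
      omega
    · rw [← C_eq_natCast, mul_assoc, reflect_C_mul, show 2 * p - 1 = p + 2 * s by omega,
        reflect_mul _ _ hEd hGd, reflect_quadratic_sum, reflect_one_sub_X_pow_sub_one_add_X_pow hodd]
      ring
    · intro i hi
      have := (X_pow_dvd_iff.1 hPX) i hi
      rwa [coeff_sub, sub_eq_zero] at this
  have hpP : (p : R[X]) * P = 0 := by
    obtain ⟨r, hr⟩ := exists_one_sub_X_pow_prime (R := R) (p := p) hodd
    have hpp' : (p : R[X]) ^ 2 = 0 := by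
      have := congrArg C hpp
      simpa using this
    ext i
    rw [← C_eq_natCast, coeff_C_mul, coeff_zero]
    rcases lt_or_ge i p with hi | hi
    · have := (X_pow_dvd_iff.1 hPX) i hi
      rw [coeff_sub, sub_eq_zero] at this
      rw [← this, ← coeff_C_mul, C_eq_natCast, hE, hr]
      rw [show (p : R[X]) * (t * (p * r) * G) = p ^ 2 * (t * r * G) by ring, hpp']
      simp
    · rw [P.coeff_eq_zero_of_natDegree_lt (by omega), mul_zero]
  -- evaluation
  have hvinv : (1 : R) - ((u⁻¹ : Rˣ) : R) = -(v * ((u⁻¹ : Rˣ) : R)) := by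
    have := u.mul_inv
    rw [huv]; linear_combination -this
  have hGe : G.eval (u : R) =
      v ^ (2 * s) * ∑ k ∈ Finset.range p, e k * (u * ((v⁻¹ : Rˣ) : R) ^ 2) ^ k := by
    rw [sum_range_eq_of_le (show s + 1 ≤ p by omega)
      (fun k h1 h2 ↦ by rw [hez k h1 h2, zero_mul]), hG, eval_finsetSum, Finset.mul_sum]
    refine Finset.sum_congr rfl fun k hk ↦ ?_
    have hk : k ≤ s := Nat.lt_succ_iff.1 (Finset.mem_range.1 hk)
    have h6 : (v : R) ^ (2 * s) * (((v⁻¹ : Rˣ) : R) ^ 2) ^ k = v ^ (2 * s - 2 * k) := by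
      rw [show 2 * s = (2 * s - 2 * k) + 2 * k by omega, pow_add, mul_assoc, ← pow_mul,
        ← mul_pow, Units.mul_inv, one_pow, mul_one]
      congr 1
      omega
    simp only [eval_mul, eval_C, eval_pow, eval_X, eval_sub, eval_one]
    rw [← huv, ← h6, mul_pow]
    ring
  have hfe (x : R) : f.eval x = ∑ k ∈ Finset.range p, c k * x ^ k := by
    rw [sum_range_eq_of_le (show a + 1 ≤ p by omega)
      (fun k h1 h2 ↦ by rw [hcz k h1 h2, zero_mul]), hf, eval_finsetSum]
    simp
  have hPe : P.eval (u : R) = v ^ (2 * s - a) * f.eval (u : R) - G.eval (u : R) := by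
    simp [hP, huv]
  have hPr : (u : R) ^ (2 * s) * P.eval ((u⁻¹ : Rˣ) : R) =
      v ^ (2 * s - a) * (u ^ a * f.eval ((u⁻¹ : Rˣ) : R)) - G.eval (u : R) := by
    have h7 := eval_reflect u hGd
    rw [hG, reflect_quadratic_sum, ← hG] at h7
    have h8 : (u : R) ^ (2 * s) = u ^ (2 * s - a) * u ^ a := by
      rw [← pow_add]; congr 1; omega
    have h9 : (u : R) ^ (2 * s - a) * ((u⁻¹ : Rˣ) : R) ^ (2 * s - a) = 1 := by
      rw [← mul_pow, Units.mul_inv, one_pow]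
    rw [h7, hP]
    simp only [eval_sub, eval_mul, eval_pow, eval_one, eval_X]
    rw [hvinv, hNe.neg_pow, mul_pow, mul_sub, h8]
    linear_combination v ^ (2 * s - a) * u ^ a * f.eval ((u⁻¹ : Rˣ) : R) * h9
  have hQe := congrArg (eval (u : R)) hQP
  rw [eval_sub, eval_reflect u (by omega), show 2 * p - 1 = p + 2 * s by omega, pow_add,
    mul_assoc (_ ^ p), hPr, hPe] at hQe
  simp only [eval_mul, eval_natCast, hE, eval_add, eval_sub, eval_pow, eval_one, eval_X,
    ← huv] at hQe
  have hpr : ((u : R) ^ (p - 1) - 1) *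
      (v ^ (2 * s - a) * (u ^ a * f.eval ((u⁻¹ : Rˣ) : R)) - G.eval (u : R)) = 0 := by
    obtain ⟨x, hx⟩ := hu
    have := congrArg (eval ((u⁻¹ : Rˣ) : R)) hpP
    rw [eval_mul, eval_natCast, eval_zero] at this
    rw [hx, ← hPr]
    linear_combination x * (u : R) ^ (2 * s) * this
  have hup : (u : R) ^ p = u * u ^ (p - 1) := by
    rw [← pow_succ']; congr 1; omega
  have hvp : (v : R) ^ p = v * v ^ (p - 1) := by
    rw [← pow_succ']; congr 1; omega
  refine ((v.isUnit).pow (2 * s - a)).mul_left_cancel ?_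
  have hva : (v : R) ^ (2 * s) = v ^ (2 * s - a) * v ^ a := by
    rw [← pow_add]; congr 1; omega
  rw [hup, hvp] at hQe
  rw [hva] at hGe
  rw [hGe] at hQe hpr
  rw [← hfe, ← hfe]
  linear_combination -hQe + u * (1 - t) * hpr + (t - 1) * (v ^ (2 * s - a) * v ^ a *
    ∑ k ∈ Finset.range p, e k * (u * ((v⁻¹ : Rˣ) : R) ^ 2) ^ k) * huv

theorem eval_ascPochhammer_eq_prod (x : R) (k : ℕ) :
    (ascPochhammer R k).eval x = ∏ j ∈ Finset.range k, (x + j) := by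
  induction k with
  | zero => simp
  | succ k ih => rw [ascPochhammer_succ_eval, ih, Finset.prod_range_succ]

theorem prod_sq_eq_prod_neg_sub_sq (x : R) (k : ℕ) :
    (∏ j ∈ Finset.range k, (x + j)) ^ 2 = (∏ j ∈ Finset.range k, (-x - j)) ^ 2 := by
  rw [← Finset.prod_pow, ← Finset.prod_pow]
  exact Finset.prod_congr rfl fun j _ ↦ by ring

theorem neg_four_pow_mul_prod {w : R} (hw : 2 * w = 1) (x : R) (k : ℕ) :
    (-4) ^ k * ((∏ j ∈ Finset.range k, (x * w + j)) * ∏ j ∈ Finset.range k, ((1 - x) * w + j)) =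
      (∏ j ∈ Finset.range k, (-x - 2 * j)) * ∏ j ∈ Finset.range k, (-x + 2 * j + 1) := by
  rw [← Finset.prod_mul_distrib, ← Finset.prod_mul_distrib, ← Finset.card_range k,
    ← Finset.prod_const, Finset.card_range, ← Finset.prod_mul_distrib]
  refine Finset.prod_congr rfl fun j _ ↦ ?_
  linear_combination (-x * (1 - x) * (2 * w + 1) - 2 * j) * hw

theorem zpow_eq_mul_one_add_mul {p a t : ℕ} (hpp : (p : R) ^ 2 = 0) {u : Rˣ}
    (hu : (p : R) ∣ (u : R) ^ (p - 1) - 1) (t₀ : ℕ) (ht : t = t₀ + p) {m : ℤ}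
    (hm : m = ((1 + a + t₀ * (p - 1) : ℕ) : ℤ)) :
    ((u ^ m : Rˣ) : R) = u * (1 + t * ((u : R) ^ (p - 1) - 1)) * u ^ a := by
  obtain ⟨x, hx⟩ := hu
  have h : (u : R) ^ (p - 1) = 1 + p * x := by linear_combination hx
  rw [hm, zpow_natCast, Units.val_pow_eq_pow_val, pow_add, mul_comm t₀, pow_mul, h,
    one_add_pow_of_sq_eq_zero (by rw [mul_pow, hpp, zero_mul]), ht]
  push_cast
  linear_combination -(u : R) * u ^ a * x * hpp

end TruncatedQuadratic

theorem coe_units_zpow {p : ℕ} [Fact p.Prime] (u : ℤ_[p]ˣ) (m : ℤ) :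
    (((u ^ m : ℤ_[p]ˣ) : ℤ_[p]) : ℚ_[p]) = ((u : ℤ_[p]) : ℚ_[p]) ^ m := by
  have := map_zpow (Units.map (PadicInt.Coe.ringHom (p := p)).toMonoidHom) u m
  have := congrArg Units.val this
  rw [Units.val_zpow_eq_zpow_val] at this
  exact this

theorem PadicInt.isUnit_natCast_of_coprime {p k : ℕ} [Fact p.Prime] (hk : p.Coprime k) :
    IsUnit (k : ℤ_[p]) := by
  have h : IsCoprime (p : ℤ) (k : ℤ) := Nat.isCoprime_iff_coprime.2 hk
  rw [PadicInt.isUnit_iff]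
  by_contra h1
  have h2 : ‖((k : ℤ) : ℤ_[p])‖ < 1 := by
    exact lt_of_le_of_ne (PadicInt.norm_le_one _) (by simpa using h1)
  rw [PadicInt.norm_int_lt_one_iff_dvd] at h2
  have := hk.eq_one_of_dvd (Int.natCast_dvd_natCast.1 h2)
  exact (Fact.out : p.Prime).one_lt.ne' this

theorem PadicInt.dvd_units_pow_sub_one {p : ℕ} [Fact p.Prime] (u : ℤ_[p]ˣ) :
    (p : ℤ_[p]) ∣ (u : ℤ_[p]) ^ (p - 1) - 1 := by
  rw [← Ideal.mem_span_singleton, ← PadicInt.maximalIdeal_eq_span_p, ← PadicInt.ker_toZMod,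
    RingHom.mem_ker, map_sub, map_pow, map_one, sub_eq_zero]
  exact ZMod.pow_card_sub_one_eq_one ((u.isUnit.map PadicInt.toZMod).ne_zero)

theorem res_eq_res2_mod (p : ℕ) [Fact p.Prime] (α : ℤ_[p]) : res p α = res2 p α % p := by
  have h : PadicInt.toZMod α = ((res2 p α : ℕ) : ZMod p) := by
    rw [← map_natCast PadicInt.toZMod, ← sub_eq_zero, ← map_sub, ← RingHom.mem_ker,
      PadicInt.ker_toZMod, PadicInt.maximalIdeal_eq_span_p]
    have h2 : α - (res2 p α : ℕ) ∈ RingHom.ker (PadicInt.toZModPow (p := p) 2) := by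
      rw [RingHom.mem_ker, map_sub, map_natCast, res2, ZMod.natCast_zmod_val, sub_self]
    rw [PadicInt.ker_toZModPow] at h2
    exact Ideal.span_singleton_le_span_singleton.2 (dvd_pow_self _ two_ne_zero) h2
  rw [res, h, ZMod.val_natCast]

/-- p-adic analogue of `₂F₁[α,α;1|z] = (1−z)^{−α} ₂F₁[α/2,(1−α)/2;1|−4z/(1−z)²]` mod `p²`. -/
theorem padic_quadratic_transformation_II
    (p : ℕ) [Fact p.Prime] (hp : Odd p) (α z : ℤ_[p]) (hα : Even (res p (-α)))
    (hz : IsUnit z) (hz1 : IsUnit (z - 1)) :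
    ‖(∑ k ∈ Finset.range p,
        poch p (α : ℚ_[p]) k ^ 2 / (Nat.factorial k : ℚ_[p]) ^ 2 * (z : ℚ_[p]) ^ k)
      - (z : ℚ_[p]) ^ (1 - lam2 p α) *
          ∑ k ∈ Finset.range p,
            poch p (α : ℚ_[p]) k ^ 2 / (Nat.factorial k : ℚ_[p]) ^ 2 * (z : ℚ_[p]) ^ (-(k : ℤ))
      - (1 - (z : ℚ_[p])) ^ (1 - lam2 p α) *
          ∑ k ∈ Finset.range p,
            poch p ((α : ℚ_[p]) / 2) k * poch p ((1 - (α : ℚ_[p])) / 2) k / (Nat.factorial k : ℚ_[p]) ^ 2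
              * (-4 * (z : ℚ_[p]) / (1 - (z : ℚ_[p])) ^ 2) ^ k‖
      ≤ (p : ℝ) ^ (-2 : ℤ) := by
  have hprime : p.Prime := Fact.out
  obtain ⟨u, rfl⟩ := hz
  obtain ⟨v, hv⟩ : IsUnit (1 - (u : ℤ_[p])) := by simpa using hz1.neg
  have hvQ : ((v : ℤ_[p]) : ℚ_[p]) = 1 - ((u : ℤ_[p]) : ℚ_[p]) := by rw [hv]; simp
  obtain ⟨w, hw⟩ : ∃ w : ℤ_[p], 2 * w = 1 := by
    have : IsUnit ((2 : ℕ) : ℤ_[p]) :=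
      PadicInt.isUnit_natCast_of_coprime (Nat.coprime_two_right.2 hp)
    exact (isUnit_iff_exists_inv.1 this).imp fun w h ↦ by simpa using h
  have hwQ : (w : ℚ_[p]) = 2⁻¹ := by
    have := congrArg (fun x : ℤ_[p] ↦ (x : ℚ_[p])) hw
    push_cast at this
    exact eq_inv_of_mul_eq_one_right this
  have hfac : ∀ k < p, ∃ i : ℤ_[p], (k.factorial : ℤ_[p]) * i = 1 := fun k hk ↦
    isUnit_iff_exists_inv.1 (PadicInt.isUnit_natCast_of_coprime
      (hprime.coprime_iff_not_dvd.2 fun h ↦ by have := hprime.dvd_factorial.1 h; omega))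
  choose! i hi using hfac
  have hiQ : ∀ k < p, (i k : ℚ_[p]) = (k.factorial : ℚ_[p])⁻¹ := fun k hk ↦ by
    have := congrArg (fun x : ℤ_[p] ↦ (x : ℚ_[p])) (hi k hk)
    push_cast at this
    exact eq_inv_of_mul_eq_one_right this
  -- integral versions of the coefficients
  let γ : ℕ → ℤ_[p] := fun k ↦ (∏ j ∈ Finset.range k, (α + j)) ^ 2 * i k ^ 2
  let δ : ℕ → ℤ_[p] := fun k ↦ (-4) ^ k * ((∏ j ∈ Finset.range k, (α * w + j)) *
    ∏ j ∈ Finset.range k, ((1 - α) * w + j)) * i k ^ 2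
  set l := lam2 p α with hl
  let x : ℤ_[p] := ∑ k ∈ Finset.range p, γ k * (u : ℤ_[p]) ^ k
    - ((u ^ (1 - l) : ℤ_[p]ˣ) : ℤ_[p]) * ∑ k ∈ Finset.range p, γ k * ((u⁻¹ : ℤ_[p]ˣ) : ℤ_[p]) ^ k
    - ((v ^ (1 - l) : ℤ_[p]ˣ) : ℤ_[p]) *
      ∑ k ∈ Finset.range p, δ k * (u * ((v⁻¹ : ℤ_[p]ˣ) : ℤ_[p]) ^ 2) ^ k
  have huinv : (((u⁻¹ : ℤ_[p]ˣ) : ℤ_[p]) : ℚ_[p]) = ((u : ℤ_[p]) : ℚ_[p])⁻¹ := by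
    simpa using coe_units_zpow u (-1)
  have hvinv : (((v⁻¹ : ℤ_[p]ˣ) : ℤ_[p]) : ℚ_[p]) = ((v : ℤ_[p]) : ℚ_[p])⁻¹ := by
    simpa using coe_units_zpow v (-1)
  have hcoe (y : ℤ_[p]) (k : ℕ) : poch p (y : ℚ_[p]) k =
      ((∏ j ∈ Finset.range k, (y + j) : ℤ_[p]) : ℚ_[p]) := by
    rw [poch, eval_ascPochhammer_eq_prod]
    have := map_prod (PadicInt.Coe.ringHom (p := p)) (fun j : ℕ ↦ y + j) (Finset.range k)
    refine Eq.trans ?_ this.symm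
    refine Finset.prod_congr rfl fun j _ ↦ ?_
    exact (by push_cast; rfl : (y : ℚ_[p]) + j = ((y + j : ℤ_[p]) : ℚ_[p]))
  have hγ : ∀ k < p, (γ k : ℚ_[p]) = poch p (α : ℚ_[p]) k ^ 2 / (k.factorial : ℚ_[p]) ^ 2 := by
    intro k hk
    rw [hcoe, div_eq_mul_inv, ← inv_pow, ← hiQ k hk]
    simp only [γ, PadicInt.coe_mul, PadicInt.coe_pow]
  have hδ : ∀ k < p, (δ k : ℚ_[p]) = (-4) ^ k * (poch p ((α : ℚ_[p]) / 2) k *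
      poch p ((1 - (α : ℚ_[p])) / 2) k / (k.factorial : ℚ_[p]) ^ 2) := by
    intro k hk
    have h1 : (α : ℚ_[p]) / 2 = ((α * w : ℤ_[p]) : ℚ_[p]) := by
      rw [PadicInt.coe_mul, hwQ, div_eq_mul_inv]
    have h2 : (1 - (α : ℚ_[p])) / 2 = (((1 - α) * w : ℤ_[p]) : ℚ_[p]) := by
      rw [PadicInt.coe_mul, hwQ, div_eq_mul_inv]; simp
    rw [h1, h2, hcoe, hcoe, div_eq_mul_inv, ← inv_pow, ← hiQ k hk]
    have h4 : ((-4 : ℤ_[p]) : ℚ_[p]) = -4 := rfl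
    simp only [δ, PadicInt.coe_mul, PadicInt.coe_pow, h4]
    ring
  have hx : (x : ℚ_[p]) = (∑ k ∈ Finset.range p,
        poch p (α : ℚ_[p]) k ^ 2 / (Nat.factorial k : ℚ_[p]) ^ 2 * ((u : ℤ_[p]) : ℚ_[p]) ^ k)
      - ((u : ℤ_[p]) : ℚ_[p]) ^ (1 - l) *
          ∑ k ∈ Finset.range p, poch p (α : ℚ_[p]) k ^ 2 / (Nat.factorial k : ℚ_[p]) ^ 2 *
            ((u : ℤ_[p]) : ℚ_[p]) ^ (-(k : ℤ))
      - (1 - ((u : ℤ_[p]) : ℚ_[p])) ^ (1 - l) *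
          ∑ k ∈ Finset.range p, poch p ((α : ℚ_[p]) / 2) k * poch p ((1 - (α : ℚ_[p])) / 2) k /
            (Nat.factorial k : ℚ_[p]) ^ 2 *
              (-4 * ((u : ℤ_[p]) : ℚ_[p]) / (1 - ((u : ℤ_[p]) : ℚ_[p])) ^ 2) ^ k := by
    simp only [x, PadicInt.coe_sub, PadicInt.coe_mul, PadicInt.coe_sum, PadicInt.coe_pow,
      coe_units_zpow, huinv, hvinv]
    rw [hvQ]
    congr 1
    · congr 1
      · exact Finset.sum_congr rfl fun k hk ↦ by rw [hγ k (Finset.mem_range.1 hk)]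
      · congr 1
        exact Finset.sum_congr rfl fun k hk ↦ by
          rw [hγ k (Finset.mem_range.1 hk), zpow_neg, zpow_natCast, inv_pow]
    · congr 1
      refine Finset.sum_congr rfl fun k hk ↦ ?_
      rw [hδ k (Finset.mem_range.1 hk), mul_comm ((-4) ^ k), mul_assoc, ← mul_pow, inv_pow,
        div_eq_mul_inv (-4 * _), mul_assoc]
  rw [← hx]
  have hgoal : PadicInt.toZModPow (p := p) 2 x = 0 := by
    set φ := PadicInt.toZModPow (p := p) 2
    obtain ⟨s, hs⟩ := hp
    set a := res p (-α) with ha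
    set t₀ := res2 p (-α) / p with ht₀
    have hres : res2 p (-α) = a + p * t₀ := by
      rw [ha, res_eq_res2_mod, ht₀, Nat.mod_add_div]
    have hap : a < p := by rw [ha, res_eq_res2_mod]; exact Nat.mod_lt _ hprime.pos
    have hpp : ((p : ℕ) : ZMod (p ^ 2)) ^ 2 = 0 := by
      rw [← Nat.cast_pow, ZMod.natCast_self]
    have hn : (((a + p * (t₀ + p) : ℕ)) : ZMod (p ^ 2)) = -φ α := by
      have h1 : ((res2 p (-α) : ℕ) : ZMod (p ^ 2)) = φ (-α) := by
        rw [res2, ZMod.natCast_zmod_val]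
      rw [← map_neg, ← h1, hres]
      push_cast
      linear_combination hpp
    have hm : 1 - l = ((1 + a + t₀ * (p - 1) : ℕ) : ℤ) := by
      have h2 : ((a : ℤ) - (res2 p (-α) : ℤ)) / (p : ℤ) = -t₀ := by
        rw [hres]
        push_cast
        rw [sub_add_cancel_left, ← mul_neg, Int.mul_ediv_cancel_left _
          (by exact_mod_cast hprime.ne_zero)]
      rw [hl, lam2, ← ha, h2]
      push_cast [hprime.one_le]
      ring
    have hdvd (y : ℤ_[p]ˣ) : ((p : ℕ) : ZMod (p ^ 2)) ∣
        ((Units.map φ.toMonoidHom y : (ZMod (p ^ 2))ˣ) : ZMod (p ^ 2)) ^ (p - 1) - 1 := by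
      have := map_dvd φ (PadicInt.dvd_units_pow_sub_one y)
      simpa using this
    have hzpow (y : ℤ_[p]ˣ) : φ ((y ^ (1 - l) : ℤ_[p]ˣ) : ℤ_[p]) =
        (((Units.map φ.toMonoidHom y) ^ (1 - l) : (ZMod (p ^ 2))ˣ) : ZMod (p ^ 2)) := by
      rw [← map_zpow]; rfl
    have hinv (y : ℤ_[p]ˣ) : φ ((y⁻¹ : ℤ_[p]ˣ) : ℤ_[p]) =
        (((Units.map φ.toMonoidHom y)⁻¹ : (ZMod (p ^ 2))ˣ) : ZMod (p ^ 2)) := by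
      rw [← map_inv]; rfl
    have hval (y : ℤ_[p]ˣ) : φ (y : ℤ_[p]) =
        ((Units.map φ.toMonoidHom y : (ZMod (p ^ 2))ˣ) : ZMod (p ^ 2)) := rfl
    have key := quadratic_transformation_of_sq_eq_zero (R := ZMod (p ^ 2)) (p := p) (s := s)
      (a := a) (t := t₀ + p) (n := a + p * (t₀ + p)) (c := fun k ↦ φ (γ k)) (e := fun k ↦ φ (δ k))
      (u := Units.map φ.toMonoidHom u) (v := Units.map φ.toMonoidHom v) hs hpp hα hap rfl
      (by nlinarith [hprime.two_le]) ?_ ?_ ?_ (hdvd u)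
    · simp only [x, map_sub, map_mul, map_sum, map_pow, hzpow, hinv, hval]
      rw [zpow_eq_mul_one_add_mul hpp (hdvd u) t₀ rfl hm,
        zpow_eq_mul_one_add_mul hpp (hdvd v) t₀ rfl hm]
      linear_combination key
    · intro k hk
      rw [hn]
      have h1 : (k.factorial : ℤ_[p]) ^ 2 * γ k = (∏ j ∈ Finset.range k, (-α - j)) ^ 2 := by
        rw [← prod_sq_eq_prod_neg_sub_sq]
        linear_combination (∏ j ∈ Finset.range k, (α + j)) ^ 2 *
          ((k.factorial : ℤ_[p]) * i k + 1) * hi k hk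
      simpa using congrArg φ h1
    · intro k hk
      rw [hn]
      have h1 : (k.factorial : ℤ_[p]) ^ 2 * δ k = (∏ j ∈ Finset.range k, (-α - 2 * j)) *
          ∏ j ∈ Finset.range k, (-α + 2 * j + 1) := by
        rw [← neg_four_pow_mul_prod hw]
        linear_combination (-4) ^ k * ((∏ j ∈ Finset.range k, (α * w + j)) *
          ∏ j ∈ Finset.range k, ((1 - α) * w + j)) *
          ((k.factorial : ℤ_[p]) * i k + 1) * hi k hk
      have h2 : φ 2 = 2 := map_ofNat φ 2
      simpa [h2] using congrArg φ h1
    · rw [← hval, ← hval, hv, map_sub, map_one]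
  have hmem : x ∈ RingHom.ker (PadicInt.toZModPow (p := p) 2) := hgoal
  rw [PadicInt.ker_toZModPow, ← PadicInt.norm_le_pow_iff_mem_span_pow] at hmem
  rw [PadicInt.norm_def] at hmem
  exact_mod_cast hmem
end

section
/- Let p be an odd prime and α, z ∈ ℤ_p such that both z − 1 and z − 2 are units of ℤ_p. Set λ = λ_p^{(2)}(α). Then ∑_{k=0}^{p−1} (α)_k(1/2)_k/(k!)² · z^k + (1−z)^{1−λ} · ∑_{k=0}^{p−1} (α)_k(1/2)_k/(k!)² · (z/(z−1))^k ≡ 2·(1 − z/2)^{1−λ} · ∑_{k=0}^{p−1} (α/2)_k((1+α)/2)_k/(k!)² · (z²/(z−2)²)^k (mod p²). -/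
open scoped BigOperators

open Polynomial

section
variable {K : Type*} [Field K]

lemma ascPochhammer_eval_succ_right (x : K) (k : ℕ) :
    (ascPochhammer K (k + 1)).eval x = (ascPochhammer K k).eval x * (x + k) := by
  simp [ascPochhammer_succ_right]

lemma ascPochhammer_eval_add (x : K) (m k : ℕ) :
    (ascPochhammer K (m + k)).eval x =
      (ascPochhammer K m).eval x * (ascPochhammer K k).eval (x + m) := by
  rw [← ascPochhammer_mul]
  simp

lemma ascPochhammer_eval_neg_natCast (N k : ℕ) :
    (ascPochhammer K k).eval (-(N : K)) = (-1) ^ k * k.factorial * N.choose k := by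
  induction k with
  | zero => simp
  | succ k ih =>
    rw [ascPochhammer_eval_succ_right, ih]
    have h := Nat.choose_succ_right_eq N k
    rcases le_or_gt k N with hk | hk
    · have h' : (N.choose (k + 1) : K) * (k + 1) = N.choose k * (N - k) := by
        have := congrArg (Nat.cast : ℕ → K) h
        push_cast [Nat.cast_sub hk] at this
        exact this
      rw [Nat.factorial_succ]
      push_cast
      linear_combination (-1) ^ k * (k.factorial : K) * h'
    · simp [Nat.choose_eq_zero_of_lt hk, Nat.choose_eq_zero_of_lt (Nat.lt_succ_of_lt hk)]

lemma ascPochhammer_eval_half [CharZero K] (k : ℕ) :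
    (ascPochhammer K k).eval (1 / 2) = k.factorial * k.centralBinom / 4 ^ k := by
  induction k with
  | zero => simp
  | succ k ih =>
    rw [ascPochhammer_eval_succ_right, ih, Nat.factorial_succ]
    have h : ((k : K) + 1) * (k + 1).centralBinom = 2 * (2 * k + 1) * k.centralBinom := by
      exact_mod_cast Nat.succ_mul_centralBinom_succ k
    push_cast
    field_simp
    linear_combination (-2 * k.factorial * 4 ^ k : K) * h

lemma ascPochhammer_eval_half_mul [CharZero K] (x : K) (k : ℕ) :
    (ascPochhammer K k).eval (x / 2) * (ascPochhammer K k).eval ((1 + x) / 2) =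
      (ascPochhammer K (2 * k)).eval x / 4 ^ k := by
  induction k with
  | zero => simp
  | succ k ih =>
    rw [show 2 * (k + 1) = 2 * k + 1 + 1 by ring]
    simp only [ascPochhammer_eval_succ_right]
    have : (ascPochhammer K (2 * k)).eval x =
      4 ^ k * ((ascPochhammer K k).eval (x / 2) * (ascPochhammer K k).eval ((1 + x) / 2)) := by
      rw [ih]; field_simp
    rw [this]
    push_cast
    field_simp
    ring

lemma sum_range_two_mul_of_odd_eq_zero (g : ℕ → K) (hg : ∀ k, g (2 * k + 1) = 0) (M : ℕ) :
    ∑ k ∈ Finset.range (2 * M), g k = ∑ k ∈ Finset.range M, g (2 * k) := by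
  induction M with
  | zero => simp
  | succ M ih =>
    rw [show 2 * (M + 1) = 2 * M + 1 + 1 by ring, Finset.sum_range_succ, Finset.sum_range_succ,
      Finset.sum_range_succ, ih, hg, add_zero]

lemma coeff_X_sq_add_one_pow_two_mul (k : ℕ) :
    ((X ^ 2 + 1 : K[X]) ^ (2 * k)).coeff (2 * k) = k.centralBinom := by
  have : (X ^ 2 + 1 : K[X]) ^ (2 * k) = expand K 2 ((X + 1) ^ (2 * k)) := by simp
  rw [this, mul_comm 2 k, coeff_expand_mul two_pos, coeff_X_add_one_pow, mul_comm,
    Nat.centralBinom]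

lemma coeff_X_sq_add_one_pow_odd (k : ℕ) :
    ((X ^ 2 + 1 : K[X]) ^ (2 * k + 1)).coeff (2 * k + 1) = 0 := by
  have : (X ^ 2 + 1 : K[X]) ^ (2 * k + 1) = expand K 2 ((X + 1) ^ (2 * k + 1)) := by simp
  rw [this, coeff_expand two_pos, if_neg (by omega)]

lemma coeff_X_sub_one_pow_two_mul (k : ℕ) :
    ((X - 1 : K[X]) ^ (2 * k)).coeff k = (-1) ^ k * k.centralBinom := by
  have := coeff_X_add_C_pow (-1 : K) (2 * k) k
  rw [C_neg, C_1, ← sub_eq_add_neg] at this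
  rw [this, Nat.centralBinom, show 2 * k - k = k by omega]

lemma coeff_add_linear_pow (A : K[X]) (a b : K) (N : ℕ) :
    ((C a * X + C b * A) ^ N).coeff N =
      ∑ k ∈ Finset.range (N + 1), N.choose k * b ^ k * a ^ (N - k) * (A ^ k).coeff k := by
  rw [add_comm, add_pow, finsetSum_coeff]
  refine Finset.sum_congr rfl fun k hk ↦ ?_
  have hk' : k ≤ N := Nat.lt_succ_iff.1 (Finset.mem_range.1 hk)
  have : (C b * A) ^ k * (C a * X) ^ (N - k) * (N.choose k : K[X]) =
      C (N.choose k * b ^ k * a ^ (N - k)) * (A ^ k * X ^ (N - k)) := by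
    simp only [mul_pow, map_mul, map_pow, map_natCast]
    ring
  rw [this, coeff_C_mul, coeff_mul_X_pow', if_pos (Nat.sub_le _ _), Nat.sub_sub_self hk']

/-- The terminating case of the quadratic transformation of `₂F₁[α, 1/2; 1 | z]`. -/
lemma sum_choose_mul_centralBinom_quadratic [CharZero K] (N M : ℕ) (hM : N < 2 * M) (z : K)
    (hz : z - 2 ≠ 0) :
    ∑ k ∈ Finset.range (N + 1), (-1) ^ k * N.choose k * k.centralBinom / 4 ^ k * z ^ k =
      (1 - z / 2) ^ N * ∑ k ∈ Finset.range M,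
        N.choose (2 * k) * k.centralBinom / 4 ^ k * (z ^ 2 / (z - 2) ^ 2) ^ k := by
  have h1 := coeff_add_linear_pow ((X - 1) ^ 2 : K[X]) 2 (z / 2) N
  have h2 := coeff_add_linear_pow (X ^ 2 + 1 : K[X]) (2 - z) (z / 2) N
  have e : C 2 * X + C (z / 2) * (X - 1) ^ 2 = C (2 - z) * X + C (z / 2) * (X ^ 2 + 1 : K[X]) := by
    have : (C z : K[X]) = C (z / 2) * C 2 := by rw [← C_mul]; congr 1; field_simp
    have h : (C (2 : K) : K[X]) = 2 := rfl
    rw [C_sub, this, h]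
    ring
  rw [e, h2] at h1
  have hl : ∑ k ∈ Finset.range (N + 1), (-1) ^ k * (N.choose k : K) * k.centralBinom / 4 ^ k * z ^ k =
      (2 ^ N)⁻¹ * ∑ k ∈ Finset.range (N + 1), N.choose k * (z / 2) ^ k * 2 ^ (N - k) *
        (((X - 1) ^ 2 : K[X]) ^ k).coeff k := by
    rw [Finset.mul_sum]
    refine Finset.sum_congr rfl fun k hk ↦ ?_
    have hk' : k ≤ N := Nat.lt_succ_iff.1 (Finset.mem_range.1 hk)
    rw [← pow_mul, coeff_X_sub_one_pow_two_mul, div_pow, ← Nat.add_sub_cancel' hk', pow_add,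
      show (4 : K) = 2 * 2 by norm_num, mul_pow]
    simp only [Nat.add_sub_cancel' hk']
    field_simp
  rw [hl, ← h1]
  have hext : ∑ k ∈ Finset.range (N + 1), N.choose k * (z / 2) ^ k * (2 - z) ^ (N - k) *
        ((X ^ 2 + 1 : K[X]) ^ k).coeff k = ∑ k ∈ Finset.range (2 * M),
        N.choose k * (z / 2) ^ k * (2 - z) ^ (N - k) * ((X ^ 2 + 1 : K[X]) ^ k).coeff k := by
    refine Finset.sum_subset (fun k hk ↦ ?_) fun k _ hk ↦ ?_
    · simp only [Finset.mem_range] at *; omega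
    · rw [Nat.choose_eq_zero_of_lt (by simpa using hk)]; simp
  rw [hext, sum_range_two_mul_of_odd_eq_zero _ (fun k ↦ by simp [coeff_X_sq_add_one_pow_odd]),
    Finset.mul_sum, Finset.mul_sum]
  refine Finset.sum_congr rfl fun k _ ↦ ?_
  rw [coeff_X_sq_add_one_pow_two_mul]
  rcases lt_or_ge N (2 * k) with hk | hk
  · simp [Nat.choose_eq_zero_of_lt hk]
  · obtain ⟨r, rfl⟩ := Nat.exists_eq_add_of_le hk
    have hz' : (2 - z) ≠ 0 := fun h ↦ hz (by linear_combination -h)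
    rw [Nat.add_sub_cancel_left, show 1 - z / 2 = (2 - z) / 2 by field_simp,
      show (z - 2) ^ 2 = (2 - z) ^ 2 by ring]
    simp only [pow_add, div_pow, pow_mul]
    field_simp
    rw [show (4 : K) = 2 ^ 2 by norm_num, ← pow_mul]
    ring

/-- Iterated differences of the sequence `(b)_j / (c)_j`; at `m = 0` the Chu–Vandermonde sum. -/
lemma sum_neg_one_pow_choose_ascPochhammer_div (b c : K) (hc : ∀ j : ℕ, c + j ≠ 0) (k m : ℕ) :
    ∑ j ∈ Finset.range (k + 1), (-1) ^ j * k.choose j *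
      ((ascPochhammer K (j + m)).eval b / (ascPochhammer K (j + m)).eval c) =
    (ascPochhammer K k).eval (c - b) * (ascPochhammer K m).eval b /
      (ascPochhammer K (m + k)).eval c := by
  have hne : ∀ j, (ascPochhammer K j).eval c ≠ 0 := by
    intro j
    induction j with
    | zero => simp
    | succ j ih => rw [ascPochhammer_eval_succ_right]; exact mul_ne_zero ih (hc j)
  induction k generalizing m with
  | zero => simp
  | succ k ih =>
    have step : ∀ f : ℕ → K, ∑ j ∈ Finset.range (k + 1 + 1), (-1) ^ j * ((k + 1).choose j : K) * f j =
        ∑ j ∈ Finset.range (k + 1), (-1) ^ j * (k.choose j : K) * f j -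
        ∑ j ∈ Finset.range (k + 1), (-1) ^ j * (k.choose j : K) * f (j + 1) := by
      intro f
      have h0 : ∑ j ∈ Finset.range (k + 1), (-1) ^ j * (k.choose j : K) * f j =
          ∑ j ∈ Finset.range (k + 2), (-1) ^ j * (k.choose j : K) * f j := by
        rw [Finset.sum_range_succ _ (k + 1)]; simp
      rw [h0, Finset.sum_range_succ', Finset.sum_range_succ' _ (k + 1)]
      simp only [Nat.choose_succ_succ, pow_succ]
      push_cast
      rw [add_sub_right_comm, ← Finset.sum_sub_distrib]
      congr 1
      · refine Finset.sum_congr rfl fun j _ ↦ by ring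
      · simp
    rw [step (fun j ↦ (ascPochhammer K (j + m)).eval b / (ascPochhammer K (j + m)).eval c), ih]
    have := ih (m + 1)
    simp only [← add_assoc, add_right_comm _ 1 m] at this ⊢
    simp only [add_right_comm _ m 1] at this ⊢
    rw [this]
    rw [show m + 1 + k = m + k + 1 by ring]
    simp only [ascPochhammer_eval_succ_right]
    have := hne (m + k)
    have h2 := hc (m + k)
    push_cast at h2 ⊢
    field_simp
    ring

/-- Pfaff's transformation for a sequence fixed by the binomial transform. -/
lemma sum_choose_mul_eq_one_sub_pow_mul_sum (f : ℕ → K)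
    (hf : ∀ k, ∑ j ∈ Finset.range (k + 1), (-1) ^ j * (k.choose j : K) * f j = f k)
    (n : ℕ) (z : K) (hz : z - 1 ≠ 0) :
    ∑ j ∈ Finset.range (n + 1), (-1) ^ j * (n.choose j : K) * f j * z ^ j =
      (1 - z) ^ n * ∑ j ∈ Finset.range (n + 1),
        (-1) ^ j * (n.choose j : K) * f j * (z / (z - 1)) ^ j := by
  let L : K[X] →ₗ[K] K := (basisMonomials K).constr K f
  have hL : ∀ (a : K) (j : ℕ), L (C a * X ^ j) = a * f j := by
    intro a j
    rw [← smul_eq_C_mul, map_smul, smul_eq_mul]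
    congr 1
    have := (basisMonomials K).constr_basis K f j
    simp only [coe_basisMonomials, monomial_one_right_eq_X_pow] at this
    exact this
  have hL1 : ∀ k : ℕ, L ((1 - X) ^ k) = f k := by
    intro k
    rw [← hf k, show (1 - X : K[X]) = -X + 1 by ring, add_pow, map_sum]
    refine Finset.sum_congr rfl fun j _ ↦ ?_
    rw [← hL]
    congr 1
    rw [neg_pow]
    simp only [map_mul, map_pow, map_neg, map_one, map_natCast]
    ring
  have key : ((1 - C z * (1 - X)) ^ n : K[X]) = (C z * X + C (1 - z)) ^ n := by
    rw [C_sub, C_1]; ring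
  rw [show (1 - C z * (1 - X) : K[X]) = C (-z) * (1 - X) + 1 by rw [C_neg]; ring,
    add_pow, add_pow] at key
  have := congrArg L key
  rw [map_sum, map_sum] at this
  rw [Finset.mul_sum]
  convert this using 1
  · refine Finset.sum_congr rfl fun j _ ↦ ?_
    rw [show ((C (-z) * (1 - X)) ^ j * 1 ^ (n - j) * (n.choose j : K[X]) : K[X]) =
      C ((-z) ^ j * n.choose j) * (1 - X) ^ j by
        simp only [map_mul, map_pow, map_natCast, mul_pow]; ring,
      ← smul_eq_C_mul, map_smul, hL1, neg_pow, smul_eq_mul]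
    ring
  · refine Finset.sum_congr rfl fun j hj ↦ ?_
    obtain ⟨r, rfl⟩ := Nat.exists_eq_add_of_le (Nat.lt_succ_iff.1 (Finset.mem_range.1 hj))
    rw [show ((C z * X) ^ j * C (1 - z) ^ (j + r - j) * ((j + r).choose j : K[X]) : K[X]) =
      C (z ^ j * (1 - z) ^ r * (j + r).choose j) * X ^ j by
        simp only [map_mul, map_pow, map_natCast, Nat.add_sub_cancel_left]; ring, hL]
    rw [show z - 1 = -(1 - z) by ring, div_neg, neg_pow (z / (1 - z)), pow_add, div_pow]
    have : 1 - z ≠ 0 := fun h ↦ hz (by linear_combination -h)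
    have h1 : ((-1 : K) ^ j) * (-1) ^ j = 1 := by rw [← mul_pow]; simp
    field_simp
    linear_combination (f j * (j + r).choose j * z ^ j) * h1

lemma pfaff_ascPochhammer (b : K) (hb : ∀ j : ℕ, 2 * b + j ≠ 0) (n : ℕ) (z : K) (hz : z - 1 ≠ 0) :
    ∑ j ∈ Finset.range (n + 1), (-1) ^ j * (n.choose j : K) *
        ((ascPochhammer K j).eval b / (ascPochhammer K j).eval (2 * b)) * z ^ j =
      (1 - z) ^ n * ∑ j ∈ Finset.range (n + 1), (-1) ^ j * (n.choose j : K) *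
        ((ascPochhammer K j).eval b / (ascPochhammer K j).eval (2 * b)) * (z / (z - 1)) ^ j := by
  refine sum_choose_mul_eq_one_sub_pow_mul_sum
    (fun j ↦ (ascPochhammer K j).eval b / (ascPochhammer K j).eval (2 * b)) (fun k ↦ ?_) n z hz
  have := sum_neg_one_pow_choose_ascPochhammer_div b (2 * b) hb k 0
  simp only [add_zero, zero_add] at this
  rw [this, show 2 * b - b = b by ring]
  simp

end
section
variable (p : ℕ) [Fact p.Prime]

lemma PadicInt.exists_coe_eq {x : ℚ_[p]} (hx : ‖x‖ ≤ 1) : ∃ c : ℤ_[p], (c : ℚ_[p]) = x := ⟨⟨x, hx⟩, rfl⟩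

lemma Padic.norm_natCast_eq_one_of_not_dvd {m : ℕ} (hm : ¬ p ∣ m) : ‖(m : ℚ_[p])‖ = 1 :=
  Padic.norm_natCast_eq_one_iff.2 ((Nat.Prime.coprime_iff_not_dvd Fact.out).2 hm)

lemma norm_ascPochhammer_eval_le_one {x : ℚ_[p]} (hx : ‖x‖ ≤ 1) (k : ℕ) :
    ‖(ascPochhammer ℚ_[p] k).eval x‖ ≤ 1 := by
  obtain ⟨c, rfl⟩ := PadicInt.exists_coe_eq p hx
  have : (ascPochhammer ℚ_[p] k).eval (c : ℚ_[p]) = ((ascPochhammer ℤ_[p] k).eval c : ℤ_[p]) := by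
    induction k with
    | zero => simp
    | succ k ih => simp only [ascPochhammer_succ_right, eval_mul, ih]; simp
  rw [this]
  exact PadicInt.norm_le_one _

/-- Functions `f (s, r)` that are affine in `p * s` modulo `p²` and do not depend on `r`
modulo `p²`. -/
def affineModSq : Subring (ℕ × ℤ_[p] → ℚ_[p]) where
  carrier := {f | ∃ (a b : ℤ_[p]) (g : ℕ × ℤ_[p] → ℤ_[p]),
    ∀ i, f i = a + p * i.1 * b + p ^ 2 * g i}
  mul_mem' := by
    rintro f f' ⟨a, b, g, h⟩ ⟨a', b', g', h'⟩
    refine ⟨a * a', a * b' + a' * b, fun i ↦ i.1 ^ 2 * b * b' + g i * (a' + p * i.1 * b') +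
      g' i * (a + p * i.1 * b) + p ^ 2 * g i * g' i, fun i ↦ ?_⟩
    simp only [Pi.mul_apply, h, h']
    push_cast
    ring
  one_mem' := ⟨1, 0, 0, fun i ↦ by simp⟩
  add_mem' := by
    rintro f f' ⟨a, b, g, h⟩ ⟨a', b', g', h'⟩
    refine ⟨a + a', b + b', fun i ↦ g i + g' i, fun i ↦ ?_⟩
    simp only [Pi.add_apply, h, h']
    push_cast
    ring
  zero_mem' := ⟨0, 0, 0, fun i ↦ by simp⟩
  neg_mem' := by
    rintro f ⟨a, b, g, h⟩
    refine ⟨-a, -b, fun i ↦ -g i, fun i ↦ ?_⟩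
    simp only [Pi.neg_apply, h]
    push_cast
    ring

variable {p}

lemma const_mem_affineModSq {x : ℚ_[p]} (hx : ‖x‖ ≤ 1) : (fun _ ↦ x) ∈ affineModSq p := by
  obtain ⟨c, rfl⟩ := PadicInt.exists_coe_eq p hx
  exact ⟨c, 0, 0, fun i ↦ by simp⟩

lemma ascPochhammer_mem_affineModSq {f : ℕ × ℤ_[p] → ℚ_[p]} (hf : f ∈ affineModSq p) (k : ℕ) :
    (fun i ↦ (ascPochhammer ℚ_[p] k).eval (f i)) ∈ affineModSq p := by
  induction k with
  | zero =>
    simp only [ascPochhammer_zero, eval_one]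
    exact one_mem (affineModSq p)
  | succ k ih =>
    simp only [ascPochhammer_eval_succ_right]
    exact mul_mem ih (add_mem hf (natCast_mem _ k))

lemma pow_fst_mem_affineModSq {u : ℚ_[p]} (hu : ∃ c : ℤ_[p], u = 1 + p * c) :
    (fun i : ℕ × ℤ_[p] ↦ u ^ i.1) ∈ affineModSq p := by
  obtain ⟨c, rfl⟩ := hu
  have h : ∀ s : ℕ, ∃ g : ℤ_[p], (1 + p * c : ℚ_[p]) ^ s = 1 + p * s * c + p ^ 2 * g := by
    intro s
    induction s with
    | zero => exact ⟨0, by simp⟩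
    | succ s ih =>
      obtain ⟨g, hg⟩ := ih
      refine ⟨s * c ^ 2 + g * (1 + p * c), ?_⟩
      rw [pow_succ, hg]
      push_cast
      ring
  choose g hg using h
  exact ⟨1, c, fun i ↦ g i.1, fun i ↦ by simpa using hg i.1⟩

lemma exists_eq_sq_mul_of_mem_affineModSq {f : ℕ × ℤ_[p] → ℚ_[p]} (hf : f ∈ affineModSq p)
    (h0 : ∃ c : ℤ_[p], f (0, 0) = p ^ 2 * c) (h1 : ∃ c : ℤ_[p], f (1, 0) = p ^ 2 * c)
    (i : ℕ × ℤ_[p]) : ∃ c : ℤ_[p], f i = p ^ 2 * c := by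
  obtain ⟨a, b, g, h⟩ := hf
  obtain ⟨c₀, h0⟩ := h0
  obtain ⟨c₁, h1⟩ := h1
  rw [h] at h0 h1
  refine ⟨(1 - i.1) * (c₀ - g (0, 0)) + i.1 * (c₁ - g (1, 0)) + g i, ?_⟩
  rw [h]
  push_cast at h0 h1 ⊢
  linear_combination (1 - (i.1 : ℚ_[p])) * h0 + (i.1 : ℚ_[p]) * h1

lemma exists_pow_sub_one_eq_one_add {x : ℚ_[p]} (hx : ‖x‖ = 1) :
    ∃ c : ℤ_[p], x ^ (p - 1) = 1 + p * c := by
  obtain ⟨y, rfl⟩ := PadicInt.exists_coe_eq p hx.le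
  have hy : IsUnit y := PadicInt.isUnit_iff.2 hx
  have h : PadicInt.toZMod (y ^ (p - 1) - 1) = 0 := by
    rw [map_sub, map_pow, map_one,
      ZMod.pow_card_sub_one_eq_one (hy.map PadicInt.toZMod).ne_zero, sub_self]
  rw [← RingHom.mem_ker, PadicInt.ker_toZMod, PadicInt.maximalIdeal_eq_span_p,
    Ideal.mem_span_singleton] at h
  obtain ⟨c, hc⟩ := h
  refine ⟨c, ?_⟩
  have := congrArg (fun x : ℤ_[p] ↦ (x : ℚ_[p])) hc
  push_cast at this
  linear_combination this

lemma res2_mod (x : ℤ_[p]) : res2 p x % p = res p x ∧ ∃ r : ℤ_[p], x = res2 p x + p ^ 2 * r := by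
  have h : PadicInt.toZModPow 2 (x - (res2 p x : ℤ_[p])) = 0 := by
    have : NeZero (p ^ 2) := ⟨pow_ne_zero _ (Fact.out : p.Prime).ne_zero⟩
    rw [map_sub, map_natCast, res2, ZMod.natCast_zmod_val, sub_self]
  rw [← RingHom.mem_ker, PadicInt.ker_toZModPow, Ideal.mem_span_singleton] at h
  obtain ⟨r, hr⟩ := h
  have hx : x = res2 p x + p ^ 2 * r := by linear_combination hr
  refine ⟨?_, r, hx⟩
  have := congrArg PadicInt.toZMod hx
  rw [map_add, map_mul, map_pow, map_natCast, map_natCast, CharP.cast_eq_zero (ZMod p) p] at this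
  conv_rhs => rw [res, this]
  simp [ZMod.val_natCast]

lemma one_sub_lam2 (α : ℤ_[p]) :
    1 - lam2 p α = ((1 + res p (-α) + (p - 1) * (res2 p (-α) / p) : ℕ) : ℤ) := by
  have hp : 0 < p := (Fact.out : p.Prime).pos
  have h : (res2 p (-α) : ℤ) = res p (-α) + p * (res2 p (-α) / p : ℕ) := by
    rw [← (res2_mod (-α)).1]; exact_mod_cast (Nat.mod_add_div _ _).symm
  rw [lam2, h, show (res p (-α) : ℤ) - (res p (-α) + p * (res2 p (-α) / p : ℕ)) =
    p * -(res2 p (-α) / p : ℕ) by ring, Int.mul_ediv_cancel_left _ (by exact_mod_cast hp.ne')]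
  push_cast [Nat.cast_sub hp]
  ring

/-- Modulo `p²`, the quotient `j! / ((1 + p)_j)²` is `1 / (1 + 2p)_j`. -/
lemma exists_factorial_div_sq_eq {j : ℕ} (hj : j < p) :
    ∃ a e : ℤ_[p], 1 / (ascPochhammer ℚ_[p] j).eval (1 + 2 * p : ℚ_[p]) = a ∧
      (j.factorial : ℚ_[p]) / (ascPochhammer ℚ_[p] j).eval (1 + p : ℚ_[p]) ^ 2 =
        a + p ^ 2 * e := by
  induction j with
  | zero => exact ⟨1, 0, by simp⟩
  | succ j ih =>
    obtain ⟨a, e, ha, he⟩ := ih (Nat.lt_of_succ_lt hj)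
    have hnd : ∀ m : ℕ, ‖((j + 1 + m * p : ℕ) : ℚ_[p])‖ = 1 := by
      intro m
      apply Padic.norm_natCast_eq_one_of_not_dvd
      rw [Nat.dvd_add_left (dvd_mul_left _ _)]
      exact Nat.not_dvd_of_pos_of_lt (Nat.succ_pos _) hj
    have h1 := hnd 1
    have h2 := hnd 2
    have hx : ∀ m : ℕ, ((j + 1 + m * p : ℕ) : ℚ_[p]) ≠ 0 := fun m h ↦ by
      have := hnd m; rw [h] at this; simp at this
    have n1 := hx 1
    have n2 := hx 2
    obtain ⟨b, hb⟩ := PadicInt.exists_coe_eq p (x := (((j + 1 + 2 * p : ℕ) : ℚ_[p]))⁻¹)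
      (by rw [norm_inv, h2, inv_one])
    obtain ⟨c, hc⟩ := PadicInt.exists_coe_eq p (x := (((j + 1 + 1 * p : ℕ) : ℚ_[p]))⁻¹)
      (by rw [norm_inv, h1, inv_one])
    push_cast at n1 n2 hb hc
    rw [one_mul] at n1 hc
    refine ⟨a * b, e * b - (a + p ^ 2 * e) * c ^ 2 * b, ?_, ?_⟩
    · push_cast
      rw [ascPochhammer_eval_succ_right, ← ha, hb, one_div, one_div, mul_inv]
      congr 2
      ring
    · have key : ((j : ℚ_[p]) + 1) / (j + 1 + p) ^ 2 = b - p ^ 2 * c ^ 2 * b := by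
        have hB : ((j : ℚ_[p]) + 1 + 2 * p) * b = 1 := by rw [hb, mul_inv_cancel₀ n2]
        have hA : ((j : ℚ_[p]) + 1 + p) * c = 1 := by rw [hc, mul_inv_cancel₀ n1]
        rw [div_eq_mul_inv, ← inv_pow, ← hc]
        linear_combination (-((j : ℚ_[p]) + 1) * c ^ 2) * hB + b * ((j + 1 + p) * c + 1) * hA
      rw [ascPochhammer_eval_succ_right, Nat.factorial_succ, Nat.cast_mul, mul_comm, mul_pow,
        mul_div_mul_comm, he, show (1 + p + j : ℚ_[p]) = j + 1 + p by ring, Nat.cast_succ, key]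
      push_cast
      ring
end

section
variable {K : Type*} [Field K]

/-- The `k`-th coefficient of `₂F₁[α, 1/2; 1 | z]`. -/
noncomputable def halfCoeff (α : K) (k : ℕ) : K :=
  (ascPochhammer K k).eval α * (ascPochhammer K k).eval (1 / 2) / (k.factorial : K) ^ 2

variable [CharZero K]

lemma halfCoeff_neg_natCast (N k : ℕ) :
    halfCoeff (-(N : K)) k = (-1) ^ k * N.choose k * k.centralBinom / 4 ^ k := by
  have : (k.factorial : K) ≠ 0 := Nat.cast_ne_zero.2 k.factorial_ne_zero
  rw [halfCoeff, ascPochhammer_eval_neg_natCast, ascPochhammer_eval_half]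
  field_simp

lemma sum_halfCoeff_range_eq {N M : ℕ} (hM : N < M) (x : K) :
    ∑ k ∈ Finset.range M, halfCoeff (-(N : K)) k * x ^ k =
      ∑ k ∈ Finset.range (N + 1), halfCoeff (-(N : K)) k * x ^ k := by
  refine (Finset.sum_subset (fun k hk ↦ ?_) fun k _ hk ↦ ?_).symm
  · simp only [Finset.mem_range] at *; omega
  · rw [halfCoeff_neg_natCast, Nat.choose_eq_zero_of_lt (by simpa using hk)]; simp

lemma sum_halfCoeff_pfaff (N : ℕ) (z : K) (hz : z - 1 ≠ 0) :
    ∑ k ∈ Finset.range (N + 1), halfCoeff (-(N : K)) k * z ^ k =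
      (1 - z) ^ N * ∑ k ∈ Finset.range (N + 1), halfCoeff (-(N : K)) k * (z / (z - 1)) ^ k := by
  have h1 : 2 * (1 / 2 : K) = 1 := by norm_num
  have h := pfaff_ascPochhammer (1 / 2 : K)
    (fun j ↦ by rw [h1, add_comm]; exact Nat.cast_add_one_ne_zero j) N z hz
  have hc : ∀ j : ℕ, (-1) ^ j * (N.choose j : K) *
      ((ascPochhammer K j).eval (1 / 2) / (ascPochhammer K j).eval (2 * (1 / 2))) =
      halfCoeff (-(N : K)) j := by
    intro j
    have : (j.factorial : K) ≠ 0 := Nat.cast_ne_zero.2 j.factorial_ne_zero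
    rw [halfCoeff_neg_natCast, h1, ascPochhammer_eval_one, ascPochhammer_eval_half]
    field_simp
  simpa only [hc] using h

lemma sum_halfCoeff_quadratic {N M : ℕ} (hM : N < 2 * M) (z : K) (hz : z - 2 ≠ 0) :
    ∑ k ∈ Finset.range (N + 1), halfCoeff (-(N : K)) k * z ^ k =
      (1 - z / 2) ^ N * ∑ k ∈ Finset.range M, (ascPochhammer K k).eval (-(N : K) / 2) *
        (ascPochhammer K k).eval ((1 + -(N : K)) / 2) / (k.factorial : K) ^ 2 *
        (z ^ 2 / (z - 2) ^ 2) ^ k := by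
  simp only [halfCoeff_neg_natCast]
  rw [sum_choose_mul_centralBinom_quadratic N M hM z hz]
  congr 1
  refine Finset.sum_congr rfl fun k _ ↦ ?_
  congr 1
  have hk : (k.factorial : K) ≠ 0 := Nat.cast_ne_zero.2 k.factorial_ne_zero
  have h : (k.centralBinom : K) * k.factorial * k.factorial = (2 * k).factorial := by
    have := Nat.add_choose_mul_factorial_mul_factorial k k
    rw [← two_mul] at this
    exact_mod_cast this
  rw [ascPochhammer_eval_half_mul, ascPochhammer_eval_neg_natCast, ← h]
  rw [pow_mul, neg_one_sq, one_pow]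
  field_simp

lemma halfCoeff_neg_natCast_add (n m j : ℕ) :
    halfCoeff (-((n + m : ℕ) : K)) (m + j) = halfCoeff (-((n + m : ℕ) : K)) m *
      ((-1) ^ j * n.choose j * (ascPochhammer K j).eval (1 / 2 + m : K) *
        (j.factorial / (ascPochhammer K j).eval (1 + m : K) ^ 2)) := by
  have h := ascPochhammer_eval_add (1 : K) m j
  rw [ascPochhammer_eval_one, ascPochhammer_eval_one] at h
  rw [halfCoeff, halfCoeff, ascPochhammer_eval_add, ascPochhammer_eval_add, h,
    show (-((n + m : ℕ) : K) + m) = -(n : K) by push_cast; ring, ascPochhammer_eval_neg_natCast n j,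
    mul_pow]
  have : (m.factorial : K) ≠ 0 := Nat.cast_ne_zero.2 m.factorial_ne_zero
  have hne : (ascPochhammer K j).eval (1 + m : K) ≠ 0 := fun h' ↦
    Nat.factorial_ne_zero (m + j) (by rw [h', mul_zero] at h; exact_mod_cast h)
  field_simp

end

section
variable {p : ℕ} [Fact p.Prime]

lemma Padic.norm_div_two_le_one (hp : Odd p) {x : ℚ_[p]} (hx : ‖x‖ ≤ 1) : ‖x / 2‖ ≤ 1 := by
  have h2 : ‖(2 : ℚ_[p])‖ = 1 := by
    have := Padic.norm_natCast_eq_one_of_not_dvd p (m := 2) fun h ↦ by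
      have := (Nat.prime_dvd_prime_iff_eq Fact.out Nat.prime_two).1 h
      subst this
      exact absurd hp (by decide)
    exact_mod_cast this
  rwa [norm_div, h2, div_one]

/-- The defect of Pfaff's transformation for sums truncated at `p` vanishes modulo `p²`. -/
lemma exists_truncated_pfaff_eq (hp : Odd p) {n : ℕ} (hn : n < p) (z : ℚ_[p]) (hz : ‖z‖ ≤ 1)
    (hz1 : ‖z - 1‖ = 1) :
    ∃ c : ℤ_[p], ∑ k ∈ Finset.range p, halfCoeff (-((n + p : ℕ) : ℚ_[p])) k * z ^ k +
        (1 - z) ^ (n + p) *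
          ∑ k ∈ Finset.range p, halfCoeff (-((n + p : ℕ) : ℚ_[p])) k * (z / (z - 1)) ^ k -
        2 * ∑ k ∈ Finset.range (n + p + 1), halfCoeff (-((n + p : ℕ) : ℚ_[p])) k * z ^ k =
      p ^ 2 * c := by
  have hz0 : z - 1 ≠ 0 := fun h ↦ by rw [h] at hz1; simp at hz1
  obtain ⟨y, rfl⟩ := PadicInt.exists_coe_eq p hz
  obtain ⟨w, hw⟩ := PadicInt.exists_coe_eq p (x := (y : ℚ_[p]) / (y - 1)) (by
    rw [norm_div, hz1, div_one]; exact hz)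
  have hhalf : ‖(1 / 2 : ℚ_[p])‖ ≤ 1 := Padic.norm_div_two_le_one hp (by simp)
  have hb : ∀ j : ℕ, ∃ d : ℤ_[p], (d : ℚ_[p]) = (ascPochhammer ℚ_[p] j).eval (1 / 2 + p : ℚ_[p]) :=
    fun j ↦ PadicInt.exists_coe_eq p (norm_ascPochhammer_eval_le_one p
      ((Padic.nonarchimedean _ _).trans (max_le hhalf (PadicInt.norm_le_one (p : ℤ_[p])))) j)
  choose d hd using hb
  have he : ∀ j : ℕ, ∃ e : ℤ_[p], j ≤ n →
      (j.factorial : ℚ_[p]) / (ascPochhammer ℚ_[p] j).eval (1 + p : ℚ_[p]) ^ 2 =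
        1 / (ascPochhammer ℚ_[p] j).eval (1 + 2 * p : ℚ_[p]) + p ^ 2 * e := by
    intro j
    by_cases hj : j ≤ n
    · obtain ⟨a, e, h1, h2⟩ := exists_factorial_div_sq_eq (hj.trans_lt hn)
      exact ⟨e, fun _ ↦ by rw [h2, h1]⟩
    · exact ⟨0, fun h ↦ absurd h hj⟩
  choose e he using he
  obtain ⟨C, hC⟩ := PadicInt.exists_coe_eq p (x := halfCoeff (-((n + p : ℕ) : ℚ_[p])) p) (by
    have h4 : ‖(1 / 4 : ℚ_[p])‖ ≤ 1 := by
      have := Padic.norm_div_two_le_one hp hhalf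
      rwa [show (1 / 2 / 2 : ℚ_[p]) = 1 / 4 by norm_num] at this
    rw [halfCoeff_neg_natCast, show ((-1) ^ p * ((n + p).choose p : ℚ_[p]) * p.centralBinom / 4 ^ p) =
      ((((-1) ^ p * (n + p).choose p * p.centralBinom : ℤ_[p]) : ℤ_[p]) : ℚ_[p]) * (1 / 4) ^ p by
        push_cast; rw [div_pow]; ring, norm_mul, norm_pow]
    exact mul_le_one₀ (PadicInt.norm_le_one _) (by positivity) (pow_le_one₀ (norm_nonneg _) h4))
  have htail : ∀ x : ℚ_[p], ∑ k ∈ Finset.range p, halfCoeff (-((n + p : ℕ) : ℚ_[p])) k * x ^ k =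
      ∑ k ∈ Finset.range (n + p + 1), halfCoeff (-((n + p : ℕ) : ℚ_[p])) k * x ^ k -
      C * x ^ p * (∑ j ∈ Finset.range (n + 1), (-1) ^ j * (n.choose j : ℚ_[p]) *
        ((ascPochhammer ℚ_[p] j).eval (1 / 2 + p : ℚ_[p]) /
          (ascPochhammer ℚ_[p] j).eval (2 * (1 / 2 + p) : ℚ_[p])) * x ^ j +
        p ^ 2 * ∑ j ∈ Finset.range (n + 1), (-1) ^ j * (n.choose j : ℚ_[p]) * d j * e j * x ^ j) := by
    intro x
    rw [show n + p + 1 = p + (n + 1) by ring, Finset.sum_range_add, eq_sub_iff_add_eq,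
      add_right_inj, Finset.mul_sum, ← Finset.sum_add_distrib, Finset.mul_sum]
    refine Finset.sum_congr rfl fun j hj ↦ ?_
    rw [halfCoeff_neg_natCast_add, ← hC, he j (Nat.lt_succ_iff.1 (Finset.mem_range.1 hj)), hd,
      show (2 * (1 / 2 + p) : ℚ_[p]) = 1 + 2 * p by ring]
    ring
  have hpf := sum_halfCoeff_pfaff (n + p) (y : ℚ_[p]) hz0
  have hpf2 := pfaff_ascPochhammer (1 / 2 + p : ℚ_[p]) (fun j ↦ by
    rw [show (2 * (1 / 2 + p) + j : ℚ_[p]) = ((2 * p + j : ℕ) : ℚ_[p]) + 1 by push_cast; ring]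
    exact Nat.cast_add_one_ne_zero _) n y hz0
  have hsign : (1 - (y : ℚ_[p])) ^ p * ((y : ℚ_[p]) / (y - 1)) ^ p = -(y : ℚ_[p]) ^ p := by
    rw [← mul_pow, ← hp.neg_pow]
    congr 1
    field_simp
    ring
  rw [htail, htail]
  have hcast : ∀ v : ℤ_[p], ((∑ j ∈ Finset.range (n + 1),
      (-1) ^ j * n.choose j * d j * e j * v ^ j : ℤ_[p]) : ℚ_[p]) =
      ∑ j ∈ Finset.range (n + 1), (-1) ^ j * (n.choose j : ℚ_[p]) * d j * e j * (v : ℚ_[p]) ^ j := by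
    intro v
    rw [PadicInt.coe_sum]
    refine Finset.sum_congr rfl fun j _ ↦ ?_
    push_cast
    rfl
  refine ⟨-C * y ^ p * (∑ j ∈ Finset.range (n + 1), (-1) ^ j * n.choose j * d j * e j * y ^ j -
    (1 - y) ^ n * ∑ j ∈ Finset.range (n + 1), (-1) ^ j * n.choose j * d j * e j * w ^ j), ?_⟩
  simp only [PadicInt.coe_mul, PadicInt.coe_neg, PadicInt.coe_sub, PadicInt.coe_pow,
    PadicInt.coe_one, hcast]
  rw [mul_sub ((1 - (y : ℚ_[p])) ^ (n + p)), ← hpf, hpf2, pow_add, hw]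
  generalize (∑ j ∈ Finset.range (n + 1), (-1) ^ j * (n.choose j : ℚ_[p]) *
        ((ascPochhammer ℚ_[p] j).eval (1 / 2 + p : ℚ_[p]) /
          (ascPochhammer ℚ_[p] j).eval (2 * (1 / 2 + p) : ℚ_[p])) * ((y : ℚ_[p]) / (y - 1)) ^ j) = A
  generalize (∑ j ∈ Finset.range (n + 1), (-1) ^ j * (n.choose j : ℚ_[p]) * d j * e j *
    ((y : ℚ_[p]) / (y - 1)) ^ j) = B
  linear_combination (-(1 - (y : ℚ_[p])) ^ n * C * (A + p ^ 2 * B)) * hsign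

end

/-- p-adic analogue of `₂F₁[α,1/2;1|z] = (1−z/2)^{−α} ₂F₁[α/2,(1+α)/2;1|z²/(z−2)²]` mod `p²`. -/
theorem padic_quadratic_transformation_IV
    (p : ℕ) [Fact p.Prime] (hp : Odd p) (α z : ℤ_[p])
    (hz1 : IsUnit (z - 1)) (hz2 : IsUnit (z - 2)) :
    ‖(∑ k ∈ Finset.range p,
        poch p (α : ℚ_[p]) k * poch p ((1 : ℚ_[p]) / 2) k / (Nat.factorial k : ℚ_[p]) ^ 2 * (z : ℚ_[p]) ^ k)
      + (1 - (z : ℚ_[p])) ^ (1 - lam2 p α) *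
          ∑ k ∈ Finset.range p,
            poch p (α : ℚ_[p]) k * poch p ((1 : ℚ_[p]) / 2) k / (Nat.factorial k : ℚ_[p]) ^ 2
              * ((z : ℚ_[p]) / ((z : ℚ_[p]) - 1)) ^ k
      - 2 * (1 - (z : ℚ_[p]) / 2) ^ (1 - lam2 p α) *
          ∑ k ∈ Finset.range p,
            poch p ((α : ℚ_[p]) / 2) k * poch p ((1 + (α : ℚ_[p])) / 2) k / (Nat.factorial k : ℚ_[p]) ^ 2
              * ((z : ℚ_[p]) ^ 2 / ((z : ℚ_[p]) - 2) ^ 2) ^ k‖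
      ≤ (p : ℝ) ^ (-2 : ℤ) := by

  have hprime : p.Prime := Fact.out
  have hZ : ‖(z : ℚ_[p])‖ ≤ 1 := PadicInt.norm_le_one z
  have hZ1 : ‖(z : ℚ_[p]) - 1‖ = 1 := PadicInt.isUnit_iff.1 hz1
  have hZ2 : ‖(z : ℚ_[p]) - 2‖ = 1 := PadicInt.isUnit_iff.1 hz2
  have h2 : (z : ℚ_[p]) - 2 ≠ 0 := fun h ↦ by rw [h] at hZ2; simp at hZ2
  have hnat := (res2_mod (-α)).1
  obtain ⟨r, hr⟩ := (res2_mod (-α)).2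
  have hn : res p (-α) < p := by rw [← hnat]; exact Nat.mod_lt _ hprime.pos
  have hm : (res2 p (-α) : ℚ_[p]) = res p (-α) + p * (res2 p (-α) / p : ℕ) := by
    rw [← hnat]; exact_mod_cast (Nat.mod_add_div _ _).symm
  rw [one_sub_lam2, zpow_natCast, zpow_natCast]
  have hα : (α : ℚ_[p]) = -res p (-α) - p * (res2 p (-α) / p : ℕ) + p ^ 2 * (-r : ℤ_[p]) := by
    have := congrArg (fun x : ℤ_[p] ↦ (x : ℚ_[p])) hr
    push_cast at this ⊢
    rw [hm] at this
    linear_combination -this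
  generalize res p (-α) = n at *
  generalize res2 p (-α) / p = s at *
  rw [hα]
  clear hα hr hm hnat
  have hhalf : ∀ x : ℚ_[p], ‖x‖ ≤ 1 → ‖x / 2‖ ≤ 1 := fun x ↦ Padic.norm_div_two_le_one hp
  have hfac : ∀ k < p, ‖((k.factorial : ℚ_[p]) ^ 2)⁻¹‖ ≤ 1 := by
    intro k hk
    rw [norm_inv, norm_pow, Padic.norm_natCast_eq_one_of_not_dvd p
      fun h ↦ absurd ((Nat.Prime.dvd_factorial hprime).1 h) (by omega)]
    simp
  have hu : ‖1 - (z : ℚ_[p])‖ = 1 := by rw [norm_sub_rev]; exact hZ1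
  have hv : ‖1 - (z : ℚ_[p]) / 2‖ = 1 := by
    have h : ‖(2 : ℚ_[p])‖ = 1 := by
      refine le_antisymm (PadicInt.norm_le_one (2 : ℤ_[p])) ?_
      have := hhalf 1 (by simp)
      rw [norm_div, norm_one] at this
      exact (div_le_one (norm_pos_iff.2 two_ne_zero)).1 this
    rw [show 1 - (z : ℚ_[p]) / 2 = -((z - 2) / 2) by field_simp; ring, norm_neg, norm_div, hZ2, h,
      div_one]
  let A : ℕ × ℤ_[p] → ℚ_[p] := fun i ↦ -(n : ℚ_[p]) - p * i.1 + p ^ 2 * i.2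
  let F : ℕ × ℤ_[p] → ℚ_[p] := fun i ↦
    (∑ k ∈ Finset.range p, halfCoeff (A i) k * (z : ℚ_[p]) ^ k) +
      (1 - (z : ℚ_[p])) ^ (1 + n) * ((1 - (z : ℚ_[p])) ^ (p - 1)) ^ i.1 *
        (∑ k ∈ Finset.range p, halfCoeff (A i) k * ((z : ℚ_[p]) / (z - 1)) ^ k) -
      2 * (1 - (z : ℚ_[p]) / 2) ^ (1 + n) * ((1 - (z : ℚ_[p]) / 2) ^ (p - 1)) ^ i.1 *
        ∑ k ∈ Finset.range p, (ascPochhammer ℚ_[p] k).eval (A i / 2) *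
          (ascPochhammer ℚ_[p] k).eval ((1 + A i) / 2) * ((k.factorial : ℚ_[p]) ^ 2)⁻¹ *
          ((z : ℚ_[p]) ^ 2 / (z - 2) ^ 2) ^ k
  have hA : A ∈ affineModSq p := ⟨-n, -1, fun i ↦ i.2, fun i ↦ by simp [A]; ring⟩
  have hsum : ∀ g : ℕ → ℕ × ℤ_[p] → ℚ_[p], (∀ k < p, g k ∈ affineModSq p) →
      (fun i ↦ ∑ k ∈ Finset.range p, g k i) ∈ affineModSq p := by
    intro g hg
    have := sum_mem (S := affineModSq p) (t := Finset.range p) (f := g)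
      fun k hk ↦ hg k (Finset.mem_range.1 hk)
    convert this using 1
    ext i
    simp
  have hcoeff : ∀ x : ℚ_[p], ‖x‖ ≤ 1 →
      (fun i ↦ ∑ k ∈ Finset.range p, halfCoeff (A i) k * x ^ k) ∈ affineModSq p := by
    intro x hx
    refine hsum _ fun k hk ↦ ?_
    simp only [halfCoeff, div_eq_mul_inv _ (_ ^ 2)]
    refine mul_mem (mul_mem (mul_mem (ascPochhammer_mem_affineModSq hA k) (const_mem_affineModSq
      (norm_ascPochhammer_eval_le_one p (hhalf 1 (by simp)) k))) (const_mem_affineModSq (hfac k hk)))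
      (const_mem_affineModSq ?_)
    rw [norm_pow]
    exact pow_le_one₀ (norm_nonneg _) hx
  have hhalfA : ∀ f ∈ affineModSq p, (fun i ↦ f i / 2) ∈ affineModSq p := by
    intro f hf
    simp only [div_eq_mul_inv]
    refine mul_mem hf (const_mem_affineModSq ?_)
    simpa using hhalf 1 (by simp)
  have hF : F ∈ affineModSq p := by
    refine sub_mem (add_mem (hcoeff _ hZ) (mul_mem (mul_mem (const_mem_affineModSq ?_)
      (pow_fst_mem_affineModSq (exists_pow_sub_one_eq_one_add hu))) (hcoeff _ ?_)))
      (mul_mem (mul_mem (const_mem_affineModSq ?_)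
      (pow_fst_mem_affineModSq (exists_pow_sub_one_eq_one_add hv))) (hsum _ fun k hk ↦ ?_))
    · rw [norm_pow, hu, one_pow]
    · rw [norm_div, hZ1, div_one]; exact hZ
    · rw [norm_mul, norm_pow, hv, one_pow, mul_one]
      exact PadicInt.norm_le_one (2 : ℤ_[p])
    · refine mul_mem (mul_mem (mul_mem (ascPochhammer_mem_affineModSq (hhalfA _ hA) k)
        (ascPochhammer_mem_affineModSq (hhalfA (fun i ↦ 1 + A i) (add_mem (one_mem _) hA)) k))
        (const_mem_affineModSq (hfac k hk))) (const_mem_affineModSq ?_)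
      rw [norm_pow, norm_div, norm_pow, norm_pow, hZ2, one_pow, div_one]
      exact pow_le_one₀ (by positivity) (pow_le_one₀ (norm_nonneg _) hZ)
  have h1 : (z : ℚ_[p]) - 1 ≠ 0 := fun h ↦ by rw [h] at hZ1; simp at hZ1
  have hF0 : F (0, 0) = 0 := by
    have hA0 : A (0, 0) = -(n : ℚ_[p]) := by simp [A]
    have hq := sum_halfCoeff_quadratic (M := p) (by omega : n < 2 * p) (z : ℚ_[p]) h2
    have hpf := sum_halfCoeff_pfaff n (z : ℚ_[p]) h1
    simp only [F, hA0, sum_halfCoeff_range_eq hn, pow_zero, mul_one, pow_add, pow_one]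
    simp only [div_eq_mul_inv _ ((_ : ℚ_[p]) ^ 2)] at hq ⊢
    linear_combination (-(1 - (z : ℚ_[p]))) * hpf + (2 - (z : ℚ_[p])) * hq
  have hF1 : ∃ c : ℤ_[p], F (1, 0) = p ^ 2 * c := by
    have hA1 : A (1, 0) = -((n + p : ℕ) : ℚ_[p]) := by simp [A]; ring
    have hq := sum_halfCoeff_quadratic (M := p) (by omega : n + p < 2 * p) (z : ℚ_[p]) h2
    have he : ∀ x : ℚ_[p], x ^ (1 + n) * x ^ (p - 1) = x ^ (n + p) := by
      intro x
      rw [← pow_add]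
      congr 1
      have := hprime.pos
      omega
    obtain ⟨c, hc⟩ := exists_truncated_pfaff_eq hp hn z hZ hZ1
    refine ⟨c, ?_⟩
    rw [← hc, hq]
    simp only [F, hA1, pow_one, he, div_eq_mul_inv _ ((_ : ℚ_[p]) ^ 2)]
    rw [← he (1 - (z : ℚ_[p]) / 2)]
    ring
  obtain ⟨c, hc⟩ := exists_eq_sq_mul_of_mem_affineModSq hF ⟨0, by simpa using hF0⟩ hF1 (s, -r)
  have hgoal : ‖F (s, -r)‖ ≤ (p : ℝ) ^ (-2 : ℤ) := by
    rw [hc, norm_mul, norm_pow, Padic.norm_p, zpow_neg, inv_pow]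
    exact mul_le_of_le_one_right (by positivity) (PadicInt.norm_le_one c)
  simpa only [F, A, poch, halfCoeff, pow_add, pow_mul, mul_assoc,
    div_eq_mul_inv _ ((_ : ℚ_[p]) ^ 2)] using hgoal
end
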